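/- arXiv:2506.20395 — 2 statements merged into one kernel-verified Lean document; each statement's English description precedes it below -/
import Mathlib

section
/- Let K be a field of characteristic 0 and let A be a finite-dimensional ℤ₂-graded associative unital K-algebra which is graded-simple and central (center = K·1), with homogeneous basis u₁,…,u_a (even) and v₁,…,v_b (odd). Let Δ be the free supercommutative K-algebra on even generators s_{i,j} and odd generators t_{i,j} (1 ≤ i ≤ a+b, j ∈ ℕ), let X_j = Σ_{i=1}^{a} u_i⊗s_{i,j} + Σ_{i=1}^{b} v_i⊗t_{(a+i),j} and Y_j = Σ_{i=1}^{a} u_i⊗t_{i,j} + Σ_{i=1}^{b} v_i⊗s_{(a+i),j} be the generic elements of A⊗Δ, and let ℰ be the unital subalgebra of A⊗Δ generated by all X_j and Y_j. Let B be a ℤ₂-graded associative unital K-algebra generated by countably many homogeneous elements. Then B admits an injective graded homomorphism into A⊗F for some supercommutative K-algebra F if and only if there exists a surjective graded homomorphism φ: ℰ → B such that, setting P = ker φ and letting (P) denote the two-sided ideal of A⊗Δ generated by P, one has (P) ∩ ℰ = P. -/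
open TensorProduct

universe u

section SuperDefs

variable (K : Type u) [Field K]

/-- A ℤ₂-decomposition of a `K`-module. -/
def IsZ2Decomp {A : Type*} [AddCommGroup A] [Module K A]
    (𝒜 : ZMod 2 → Submodule K A) : Prop :=
  𝒜 0 ⊔ 𝒜 1 = ⊤ ∧ 𝒜 0 ⊓ 𝒜 1 = ⊥

/-- A ℤ₂-grading on a `K`-algebra. -/
def IsZ2Grading {A : Type*} [Ring A] [Algebra K A]
    (𝒜 : ZMod 2 → Submodule K A) : Prop :=
  IsZ2Decomp K 𝒜 ∧ (1 : A) ∈ 𝒜 0 ∧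
    ∀ i j : ZMod 2, ∀ a ∈ 𝒜 i, ∀ b ∈ 𝒜 j, a * b ∈ 𝒜 (i + j)

/-- Homogeneous elements supercommute. -/
def IsSupercommutative {A : Type*} [Ring A] [Algebra K A]
    (𝒜 : ZMod 2 → Submodule K A) : Prop :=
  ∀ i j : ZMod 2, ∀ a ∈ 𝒜 i, ∀ b ∈ 𝒜 j,
    a * b = (-1 : K) ^ (i.val * j.val) • (b * a)

/-- The super (ℤ₂-) grading on a tensor product. -/
def superTensorGrading {A Ξ : Type*} [AddCommGroup A] [Module K A]
    [AddCommGroup Ξ] [Module K Ξ]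
    (𝒜 : ZMod 2 → Submodule K A) (𝒳 : ZMod 2 → Submodule K Ξ)
    (k : ZMod 2) : Submodule K (A ⊗[K] Ξ) :=
  LinearMap.range (TensorProduct.map (𝒜 0).subtype (𝒳 k).subtype) ⊔
    LinearMap.range (TensorProduct.map (𝒜 1).subtype (𝒳 (k + 1)).subtype)

/-- A graded homomorphism of ℤ₂-graded algebras. -/
def IsGradedHom {B C : Type*} [Ring B] [Algebra K B] [Ring C] [Algebra K C]
    (ℬ : ZMod 2 → Submodule K B) (𝒞 : ZMod 2 → Submodule K C)
    (f : B →ₐ[K] C) : Prop :=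
  ∀ k : ZMod 2, ∀ b ∈ ℬ k, f b ∈ 𝒞 k

/-- A graded (homogeneous) subspace. -/
def IsGradedSubmodule {A : Type*} [AddCommGroup A] [Module K A]
    (𝒜 : ZMod 2 → Submodule K A) (W : Submodule K A) : Prop :=
  W = (W ⊓ 𝒜 0) ⊔ (W ⊓ 𝒜 1)

/-- A graded (homogeneous) subalgebra. -/
def IsGradedSubalgebra {A : Type*} [Ring A] [Algebra K A]
    (𝒜 : ZMod 2 → Submodule K A) (S : Subalgebra K A) : Prop :=
  IsGradedSubmodule K 𝒜 (Subalgebra.toSubmodule S)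

/-- A `K`-subspace which is a two-sided ideal. -/
def IsTwoSidedSubmodule {A : Type*} [Ring A] [Algebra K A]
    (I : Submodule K A) : Prop :=
  ∀ a : A, ∀ x ∈ I, a * x ∈ I ∧ x * a ∈ I

/-- Graded-simplicity: no nonzero proper graded two-sided ideals. -/
def IsGradedSimple {A : Type*} [Ring A] [Algebra K A]
    (𝒜 : ZMod 2 → Submodule K A) : Prop :=
  ∀ I : Submodule K A, IsTwoSidedSubmodule K I → IsGradedSubmodule K 𝒜 I →
    I = ⊥ ∨ I = ⊤

/-- A supercommutative `K`-algebra (algebra of superscalars). -/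
structure SuperAlg : Type (u + 1) where
  carrier : Type u
  [ring : Ring carrier]
  [alg : Algebra K carrier]
  grading : ZMod 2 → Submodule K carrier
  isGrading : IsZ2Grading K grading
  isSupercomm : IsSupercommutative K grading

attribute [instance] SuperAlg.ring SuperAlg.alg

/-- `ρ(B) ⊆ A ⊗ S` for a subalgebra `S` of `Ξ`. -/
def MapsIntoTensorSub {A B Ξ : Type u} [Ring A] [Algebra K A] [Ring B] [Algebra K B]
    [Ring Ξ] [Algebra K Ξ] (ρ : B →ₐ[K] A ⊗[K] Ξ) (S : Subalgebra K Ξ) : Prop :=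
  ∀ b : B, ρ b ∈ LinearMap.range
    (TensorProduct.map (LinearMap.id : A →ₗ[K] A) (Subalgebra.toSubmodule S).subtype)

/-- `(Ξ, ρ)` is an `A`-universal supermap for `B`. -/
def IsUniversalSupermap {A : Type u} [Ring A] [Algebra K A]
    (𝒜 : ZMod 2 → Submodule K A)
    {B : Type u} [Ring B] [Algebra K B] (ℬ : ZMod 2 → Submodule K B)
    (Ξ : SuperAlg K) (ρ : B →ₐ[K] A ⊗[K] Ξ.carrier) : Prop :=
  IsGradedHom K ℬ (superTensorGrading K 𝒜 Ξ.grading) ρ ∧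
  (∀ S : Subalgebra K Ξ.carrier, IsGradedSubalgebra K Ξ.grading S →
      MapsIntoTensorSub K ρ S → S = ⊤) ∧
  ∀ (F : SuperAlg K) (κ : B →ₐ[K] A ⊗[K] F.carrier),
    IsGradedHom K ℬ (superTensorGrading K 𝒜 F.grading) κ →
    ∃ ζ : Ξ.carrier →ₐ[K] F.carrier, IsGradedHom K Ξ.grading F.grading ζ ∧
      (Algebra.TensorProduct.map (AlgHom.id K A) ζ).comp ρ = κ

end SuperDefs

section FreeSuper

variable (K : Type u) [Field K]

/-- The free supercommutative algebra on even generators `s_p` and odd generators `t_p`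
(`p : ι`), realized as `K[s_p] ⊗ Λ(ι →₀ K)`. -/
abbrev FreeSuperAlgebra (ι : Type*) : Type _ :=
  MvPolynomial ι K ⊗[K] ExteriorAlgebra K (ι →₀ K)

/-- The even generator `s_p = X_p ⊗ 1`. -/
noncomputable def sGen {ι : Type*} (p : ι) : FreeSuperAlgebra K ι :=
  MvPolynomial.X p ⊗ₜ[K] (1 : ExteriorAlgebra K (ι →₀ K))

/-- The odd generator `t_p = 1 ⊗ e_p`. -/
noncomputable def tGen {ι : Type*} (p : ι) : FreeSuperAlgebra K ι :=
  (1 : MvPolynomial ι K) ⊗ₜ[K] ExteriorAlgebra.ι K (Finsupp.single p 1)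

/-- The trivial (purely even) ℤ₂-grading on a module. -/
def trivialEvenGrading (P : Type*) [AddCommGroup P] [Module K P] :
    ZMod 2 → Submodule K P :=
  fun k => if k = 0 then ⊤ else ⊥

/-- The ℤ₂-grading of the exterior algebra (even/odd part). -/
def exteriorGrading (V : Type*) [AddCommGroup V] [Module K V] :
    ZMod 2 → Submodule K (ExteriorAlgebra K V) :=
  fun k => CliffordAlgebra.evenOdd (0 : QuadraticForm K V) k

/-- The ℤ₂-grading on the free supercommutative algebra: the `s`'s are even, the `t`'s odd. -/
noncomputable def freeSuperGrading (ι : Type*) :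
    ZMod 2 → Submodule K (FreeSuperAlgebra K ι) :=
  superTensorGrading K (trivialEvenGrading K (MvPolynomial ι K))
    (exteriorGrading K (ι →₀ K))

variable {A : Type u} [AddCommGroup A] [Module K A]

/-- The even generic element
`X_j = Σᵢ uᵢ ⊗ s_{(i,j)} + Σᵢ vᵢ ⊗ t_{(a+i,j)}` of `A ⊗ Δ`. -/
noncomputable def genericX {a b : ℕ} (bA : Module.Basis (Fin a ⊕ Fin b) K A) (j : ℕ) :
    A ⊗[K] FreeSuperAlgebra K ((Fin a ⊕ Fin b) × ℕ) :=
  (∑ i : Fin a, bA (Sum.inl i) ⊗ₜ[K] sGen K ((Sum.inl i : Fin a ⊕ Fin b), j)) +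
    ∑ i : Fin b, bA (Sum.inr i) ⊗ₜ[K] tGen K ((Sum.inr i : Fin a ⊕ Fin b), j)

/-- The odd generic element
`Y_j = Σᵢ uᵢ ⊗ t_{(i,j)} + Σᵢ vᵢ ⊗ s_{(a+i,j)}` of `A ⊗ Δ`. -/
noncomputable def genericY {a b : ℕ} (bA : Module.Basis (Fin a ⊕ Fin b) K A) (j : ℕ) :
    A ⊗[K] FreeSuperAlgebra K ((Fin a ⊕ Fin b) × ℕ) :=
  (∑ i : Fin a, bA (Sum.inl i) ⊗ₜ[K] tGen K ((Sum.inl i : Fin a ⊕ Fin b), j)) +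
    ∑ i : Fin b, bA (Sum.inr i) ⊗ₜ[K] sGen K ((Sum.inr i : Fin a ⊕ Fin b), j)

end FreeSuper

/-- The two-sided ideal (as a `K`-subspace) generated by a set. -/
def twoSidedSpan (K : Type u) [Field K] {A : Type*} [Ring A] [Algebra K A]
    (s : Set A) : Submodule K A :=
  sInf {I : Submodule K A | IsTwoSidedSubmodule K I ∧ s ⊆ I}

/-- The algebra `ℰ` of generic superelements on `A`: the subalgebra of `A ⊗ Δ` generated by
all the generic elements `X_j` and `Y_j`. -/
noncomputable def genericSubalgebra (K : Type u) [Field K] {A : Type u}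
    [Ring A] [Algebra K A] {a b : ℕ} (bA : Module.Basis (Fin a ⊕ Fin b) K A) :
    Subalgebra K (A ⊗[K] FreeSuperAlgebra K ((Fin a ⊕ Fin b) × ℕ)) :=
  Algebra.adjoin K (Set.range (genericX K bA) ∪ Set.range (genericY K bA))

section Grading

variable {K : Type u} [Field K]

theorem IsZ2Decomp.isCompl {A : Type*} [AddCommGroup A] [Module K A]
    {𝒜 : ZMod 2 → Submodule K A} (h : IsZ2Decomp K 𝒜) : IsCompl (𝒜 0) (𝒜 1) :=
  ⟨disjoint_iff.2 h.2, codisjoint_iff.2 h.1⟩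

theorem IsZ2Decomp.exists_add {A : Type*} [AddCommGroup A] [Module K A]
    {𝒜 : ZMod 2 → Submodule K A} (h : IsZ2Decomp K 𝒜) (x : A) :
    ∃ y ∈ 𝒜 0, ∃ z ∈ 𝒜 1, y + z = x :=
  Submodule.mem_sup.1 (h.1 ▸ Submodule.mem_top)

theorem IsZ2Decomp.exists_add' {A : Type*} [AddCommGroup A] [Module K A]
    {𝒜 : ZMod 2 → Submodule K A} (h : IsZ2Decomp K 𝒜) (k : ZMod 2) (x : A) :
    ∃ y ∈ 𝒜 k, ∃ z ∈ 𝒜 (k + 1), y + z = x := by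
  obtain ⟨y, hy, z, hz, rfl⟩ := h.exists_add x
  fin_cases k
  · exact ⟨y, hy, z, hz, rfl⟩
  · exact ⟨z, hz, y, hy, add_comm _ _⟩

theorem IsZ2Decomp.eq_zero {A : Type*} [AddCommGroup A] [Module K A]
    {𝒜 : ZMod 2 → Submodule K A} (h : IsZ2Decomp K 𝒜) {k : ZMod 2} {x : A}
    (h0 : x ∈ 𝒜 k) (h1 : x ∈ 𝒜 (k + 1)) : x = 0 := by
  fin_cases k
  · exact (Submodule.mem_bot K).1 (h.2 ▸ ⟨h0, h1⟩)
  · exact (Submodule.mem_bot K).1 (h.2 ▸ ⟨h1, h0⟩)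

/-- The parity involution of a ℤ₂-graded module, `1` on the even and `-1` on the odd part. -/
noncomputable def parity {A : Type*} [AddCommGroup A] [Module K A]
    {𝒜 : ZMod 2 → Submodule K A} (h : IsZ2Decomp K 𝒜) : A →ₗ[K] A :=
  LinearMap.ofIsCompl h.isCompl (𝒜 0).subtype (-(𝒜 1).subtype)

theorem parity_even {A : Type*} [AddCommGroup A] [Module K A]
    {𝒜 : ZMod 2 → Submodule K A} (h : IsZ2Decomp K 𝒜) {x : A} (hx : x ∈ 𝒜 0) :
    parity h x = x :=
  LinearMap.ofIsCompl_apply_left h.isCompl ⟨x, hx⟩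

theorem parity_odd {A : Type*} [AddCommGroup A] [Module K A]
    {𝒜 : ZMod 2 → Submodule K A} (h : IsZ2Decomp K 𝒜) {x : A} (hx : x ∈ 𝒜 1) :
    parity h x = -x :=
  LinearMap.ofIsCompl_apply_right h.isCompl ⟨x, hx⟩

theorem parity_parity {A : Type*} [AddCommGroup A] [Module K A]
    {𝒜 : ZMod 2 → Submodule K A} (h : IsZ2Decomp K 𝒜) (x : A) :
    parity h (parity h x) = x := by
  obtain ⟨y, hy, z, hz, rfl⟩ := h.exists_add x
  simp [parity_even h hy, parity_odd h hz]

theorem parity_mul {A : Type*} [Ring A] [Algebra K A]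
    {𝒜 : ZMod 2 → Submodule K A} (h : IsZ2Grading K 𝒜) (x y : A) :
    parity h.1 (x * y) = parity h.1 x * parity h.1 y := by
  obtain ⟨x₀, hx₀, x₁, hx₁, rfl⟩ := h.1.exists_add x
  obtain ⟨y₀, hy₀, y₁, hy₁, rfl⟩ := h.1.exists_add y
  have e (i j : ZMod 2) (a : A) (ha : a ∈ 𝒜 i) (b : A) (hb : b ∈ 𝒜 j) := h.2.2 i j a ha b hb
  simp only [add_mul, mul_add, map_add, parity_even h.1 hx₀, parity_even h.1 hy₀,
    parity_odd h.1 hx₁, parity_odd h.1 hy₁, parity_even h.1 (e 0 0 _ hx₀ _ hy₀),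
    parity_odd h.1 (e 0 1 _ hx₀ _ hy₁), parity_odd h.1 (e 1 0 _ hx₁ _ hy₀),
    parity_even h.1 (e 1 1 _ hx₁ _ hy₁)]
  noncomm_ring

theorem mem_of_parity_mem [CharZero K] {A : Type*} [AddCommGroup A] [Module K A]
    {𝒜 : ZMod 2 → Submodule K A} (h : IsZ2Decomp K 𝒜) {W : Submodule K A}
    (hW : ∀ x ∈ W, parity h x ∈ W) {y z : A} (hy : y ∈ 𝒜 0) (hz : z ∈ 𝒜 1)
    (hyz : y + z ∈ W) : y ∈ W ∧ z ∈ W := by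
  have h' := hW _ hyz
  rw [map_add, parity_even h hy, parity_odd h hz] at h'
  have hy' : y ∈ W := by
    have : y = (2⁻¹ : K) • ((y + z) + (y + -z)) := by
      rw [show (y + z) + (y + -z) = (2 : K) • y by rw [two_smul]; abel, smul_smul]
      simp
    rw [this]
    exact W.smul_mem _ (W.add_mem hyz h')
  exact ⟨hy', (W.add_mem_iff_right hy').1 hyz⟩

theorem isGradedSubmodule_of_parity_mem [CharZero K] {A : Type*} [AddCommGroup A] [Module K A]
    {𝒜 : ZMod 2 → Submodule K A} (h : IsZ2Decomp K 𝒜) {W : Submodule K A}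
    (hW : ∀ x ∈ W, parity h x ∈ W) : IsGradedSubmodule K 𝒜 W := by
  refine le_antisymm (fun x hx => ?_) (sup_le inf_le_left inf_le_left)
  obtain ⟨y, hy, z, hz, rfl⟩ := h.exists_add x
  have := mem_of_parity_mem h hW hy hz hx
  exact Submodule.add_mem_sup ⟨this.1, hy⟩ ⟨this.2, hz⟩

/-- A linear involution acting by `(-1)^k` on two subspaces forces them to be independent. -/
theorem isZ2Decomp_of_involution [CharZero K] {A : Type*} [AddCommGroup A] [Module K A]
    {𝒜 : ZMod 2 → Submodule K A} (τ : A →ₗ[K] A) (h0 : ∀ x ∈ 𝒜 0, τ x = x)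
    (h1 : ∀ x ∈ 𝒜 1, τ x = -x) (htop : 𝒜 0 ⊔ 𝒜 1 = ⊤) : IsZ2Decomp K 𝒜 := by
  refine ⟨htop, (Submodule.eq_bot_iff _).2 fun x hx => ?_⟩
  have : x = -x := (h0 x hx.1).symm.trans (h1 x hx.2)
  have h2 : (2 : K) • x = 0 := by rw [two_smul]; nth_rw 2 [this]; simp
  simpa using h2

end Grading

section SuperTensor

theorem ZMod.eq_zero_or_eq_one (j : ZMod 2) : j = 0 ∨ j = 1 := by
  revert j; decide

theorem ZMod.one_add_add_one (j : ZMod 2) : 1 + j + 1 = j := by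
  revert j; decide

theorem ZMod.eq_of_add_eq_zero {i j : ZMod 2} (h : i + j = 0) :
    (i = 0 ∧ j = 0) ∨ (i = 1 ∧ j = 1) := by
  revert i j; decide

theorem ZMod.eq_of_add_eq_one {i j : ZMod 2} (h : i + j = 1) :
    (i = 0 ∧ j = 1) ∨ (i = 1 ∧ j = 0) := by
  revert i j; decide

variable {K : Type u} [Field K] {A X : Type*}

theorem tmul_mem_superTensorGrading [AddCommGroup A] [Module K A] [AddCommGroup X] [Module K X]
    {𝒜 : ZMod 2 → Submodule K A} {𝒳 : ZMod 2 → Submodule K X} {i j k : ZMod 2} {a : A} {x : X}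
    (ha : a ∈ 𝒜 i) (hx : x ∈ 𝒳 j) (hk : i + j = k) :
    a ⊗ₜ[K] x ∈ superTensorGrading K 𝒜 𝒳 k := by
  subst hk
  fin_cases i
  · exact Submodule.mem_sup_left ⟨⟨a, ha⟩ ⊗ₜ ⟨x, by change x ∈ 𝒳 (0 + j); rwa [zero_add]⟩, rfl⟩
  · refine Submodule.mem_sup_right ⟨⟨a, ha⟩ ⊗ₜ ⟨x, ?_⟩, rfl⟩
    change x ∈ 𝒳 (1 + j + 1)
    rwa [ZMod.one_add_add_one]

theorem superTensorGrading_le [AddCommGroup A] [Module K A] [AddCommGroup X] [Module K X]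
    {𝒜 : ZMod 2 → Submodule K A} {𝒳 : ZMod 2 → Submodule K X} {k : ZMod 2}
    {W : Submodule K (A ⊗[K] X)}
    (h : ∀ i j : ZMod 2, i + j = k → ∀ a ∈ 𝒜 i, ∀ x ∈ 𝒳 j, a ⊗ₜ[K] x ∈ W) :
    superTensorGrading K 𝒜 𝒳 k ≤ W := by
  refine sup_le ?_ ?_
  · rintro _ ⟨y, rfl⟩
    induction y with
    | zero => simp
    | add y z hy hz => rw [map_add]; exact W.add_mem hy hz
    | tmul a x => exact h 0 k (by simp) a a.2 x x.2
  · rintro _ ⟨y, rfl⟩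
    induction y with
    | zero => simp
    | add y z hy hz => rw [map_add]; exact W.add_mem hy hz
    | tmul a x => exact h 1 (k + 1) (by rw [← add_assoc, ZMod.one_add_add_one]) a a.2 x x.2

theorem superTensorGrading_isZ2Decomp [CharZero K] [AddCommGroup A] [Module K A] [AddCommGroup X]
    [Module K X] {𝒜 : ZMod 2 → Submodule K A} {𝒳 : ZMod 2 → Submodule K X}
    (hA : IsZ2Decomp K 𝒜) (hX : IsZ2Decomp K 𝒳) :
    IsZ2Decomp K (superTensorGrading K 𝒜 𝒳) := by
  refine isZ2Decomp_of_involution (TensorProduct.map (parity hA) (parity hX)) ?_ ?_ ?_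
  · refine superTensorGrading_le (W := LinearMap.eqLocus _ LinearMap.id) ?_
    intro i j hij a ha x hx
    simp only [LinearMap.mem_eqLocus, TensorProduct.map_tmul, LinearMap.id_apply]
    obtain ⟨rfl, rfl⟩ | ⟨rfl, rfl⟩ : (i = 0 ∧ j = 0) ∨ (i = 1 ∧ j = 1) := ZMod.eq_of_add_eq_zero hij
    · rw [parity_even hA ha, parity_even hX hx]
    · rw [parity_odd hA ha, parity_odd hX hx, TensorProduct.neg_tmul, TensorProduct.tmul_neg,
        neg_neg]
  · refine superTensorGrading_le (W := LinearMap.eqLocus _ (-LinearMap.id)) ?_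
    intro i j hij a ha x hx
    simp only [LinearMap.mem_eqLocus, TensorProduct.map_tmul, LinearMap.neg_apply,
      LinearMap.id_apply]
    obtain ⟨rfl, rfl⟩ | ⟨rfl, rfl⟩ : (i = 0 ∧ j = 1) ∨ (i = 1 ∧ j = 0) := ZMod.eq_of_add_eq_one hij
    · rw [parity_even hA ha, parity_odd hX hx, TensorProduct.tmul_neg]
    · rw [parity_odd hA ha, parity_even hX hx, TensorProduct.neg_tmul]
  · refine eq_top_iff.2 fun y _ => ?_
    induction y with
    | zero => exact Submodule.zero_mem _
    | add y z hy hz => exact Submodule.add_mem _ (hy trivial) (hz trivial)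
    | tmul a x =>
      obtain ⟨a₀, ha₀, a₁, ha₁, rfl⟩ := hA.exists_add a
      obtain ⟨x₀, hx₀, x₁, hx₁, rfl⟩ := hX.exists_add x
      simp only [TensorProduct.add_tmul, TensorProduct.tmul_add]
      have h0 {y} (hy : y ∈ superTensorGrading K 𝒜 𝒳 0) :
          y ∈ superTensorGrading K 𝒜 𝒳 0 ⊔ superTensorGrading K 𝒜 𝒳 1 :=
        Submodule.mem_sup_left hy
      have h1 {y} (hy : y ∈ superTensorGrading K 𝒜 𝒳 1) :
          y ∈ superTensorGrading K 𝒜 𝒳 0 ⊔ superTensorGrading K 𝒜 𝒳 1 :=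
        Submodule.mem_sup_right hy
      exact Submodule.add_mem _
        (Submodule.add_mem _ (h0 (tmul_mem_superTensorGrading ha₀ hx₀ rfl))
          (h1 (tmul_mem_superTensorGrading ha₁ hx₀ rfl)))
        (Submodule.add_mem _ (h1 (tmul_mem_superTensorGrading ha₀ hx₁ rfl))
          (h0 (tmul_mem_superTensorGrading ha₁ hx₁ rfl)))

theorem superTensorGrading_isZ2Grading [CharZero K] [Ring A] [Algebra K A] [Ring X]
    [Algebra K X] {𝒜 : ZMod 2 → Submodule K A} {𝒳 : ZMod 2 → Submodule K X}
    (hA : IsZ2Grading K 𝒜) (hX : IsZ2Grading K 𝒳) :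
    IsZ2Grading K (superTensorGrading K 𝒜 𝒳) := by
  refine ⟨superTensorGrading_isZ2Decomp hA.1 hX.1, ?_, ?_⟩
  · exact tmul_mem_superTensorGrading hA.2.1 hX.2.1 (by simp)
  · intro k l y hy z hz
    revert y
    change superTensorGrading K 𝒜 𝒳 k ≤
      (superTensorGrading K 𝒜 𝒳 (k + l)).comap (LinearMap.mulRight K z)
    refine superTensorGrading_le fun i j hij a ha x hx => ?_
    change a ⊗ₜ x * z ∈ superTensorGrading K 𝒜 𝒳 (k + l)
    revert z
    change superTensorGrading K 𝒜 𝒳 l ≤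
      (superTensorGrading K 𝒜 𝒳 (k + l)).comap (LinearMap.mulLeft K (a ⊗ₜ x))
    refine superTensorGrading_le fun i' j' hij' a' ha' x' hx' => ?_
    change a ⊗ₜ x * a' ⊗ₜ x' ∈ superTensorGrading K 𝒜 𝒳 (k + l)
    rw [Algebra.TensorProduct.tmul_mul_tmul]
    exact tmul_mem_superTensorGrading (hA.2.2 _ _ _ ha _ ha') (hX.2.2 _ _ _ hx _ hx')
      (by rw [← hij, ← hij']; abel)

theorem isGradedHom_tensor_map {Y : Type*} [Ring A] [Algebra K A] [Ring X]
    [Algebra K X] [Ring Y] [Algebra K Y] (𝒜 : ZMod 2 → Submodule K A)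
    {𝒳 : ZMod 2 → Submodule K X} {𝒴 : ZMod 2 → Submodule K Y} {f : X →ₐ[K] Y}
    (hf : IsGradedHom K 𝒳 𝒴 f) :
    IsGradedHom K (superTensorGrading K 𝒜 𝒳) (superTensorGrading K 𝒜 𝒴)
      (Algebra.TensorProduct.map (AlgHom.id K A) f) := by
  intro k
  change superTensorGrading K 𝒜 𝒳 k ≤ (superTensorGrading K 𝒜 𝒴 k).comap
    (Algebra.TensorProduct.map (AlgHom.id K A) f).toLinearMap
  refine superTensorGrading_le fun i j hij a ha x hx => ?_
  exact tmul_mem_superTensorGrading ha (hf _ _ hx) hij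

/-- The coordinate `A ⊗ X → X` at a basis vector of `A`. -/
noncomputable def tensorCoord {ι : Type*} [AddCommGroup A] [Module K A]
    (bA : Module.Basis ι K A) (X : Type*) [AddCommGroup X] [Module K X] (i : ι) :
    A ⊗[K] X →ₗ[K] X :=
  (TensorProduct.lid K X).toLinearMap ∘ₗ (bA.coord i).rTensor X

@[simp]
theorem tensorCoord_tmul {ι : Type*} [AddCommGroup A] [Module K A] [AddCommGroup X] [Module K X]
    (bA : Module.Basis ι K A) (i : ι) (a : A) (x : X) :
    tensorCoord bA X i (a ⊗ₜ x) = bA.coord i a • x := by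
  simp [tensorCoord]

theorem sum_tmul_tensorCoord {ι : Type*} [Fintype ι] [AddCommGroup A] [Module K A]
    [AddCommGroup X] [Module K X] (bA : Module.Basis ι K A) (y : A ⊗[K] X) :
    ∑ i, bA i ⊗ₜ[K] tensorCoord bA X i y = y := by
  induction y with
  | zero => simp
  | add y z hy hz => simp only [map_add, TensorProduct.tmul_add, Finset.sum_add_distrib, hy, hz]
  | tmul a x =>
    simp only [tensorCoord_tmul, ← TensorProduct.smul_tmul, ← TensorProduct.sum_tmul,
      Module.Basis.coord_apply, bA.sum_repr]

theorem tensorCoord_map {ι Y : Type*} [Ring A] [Algebra K A] [Ring X] [Algebra K X] [Ring Y]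
    [Algebra K Y] (bA : Module.Basis ι K A) (f : X →ₐ[K] Y) (i : ι) (y : A ⊗[K] X) :
    tensorCoord bA Y i (Algebra.TensorProduct.map (AlgHom.id K A) f y) =
      f (tensorCoord bA X i y) := by
  induction y with
  | zero => simp
  | add y z hy hz => simp only [map_add, hy, hz]
  | tmul a x => simp

theorem coord_inr_eq_zero [CharZero K] {ι κ : Type*} [AddCommGroup A] [Module K A]
    {𝒜 : ZMod 2 → Submodule K A} (hA : IsZ2Decomp K 𝒜) (bA : Module.Basis (ι ⊕ κ) K A)
    (hu : ∀ i, bA (Sum.inl i) ∈ 𝒜 0) (hv : ∀ i, bA (Sum.inr i) ∈ 𝒜 1) {a : A} (ha : a ∈ 𝒜 0)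
    (i : κ) : bA.coord (Sum.inr i) a = 0 := by
  have h : bA.coord (Sum.inr i) ∘ₗ parity hA = -bA.coord (Sum.inr i) := by
    refine bA.ext ?_
    rintro (j | j)
    · simp [parity_even hA (hu j)]
    · simp [parity_odd hA (hv j)]
  have h' := LinearMap.congr_fun h a
  rw [LinearMap.comp_apply, parity_even hA ha, LinearMap.neg_apply] at h'
  exact self_eq_neg.1 h'

theorem coord_inl_eq_zero [CharZero K] {ι κ : Type*} [AddCommGroup A] [Module K A]
    {𝒜 : ZMod 2 → Submodule K A} (hA : IsZ2Decomp K 𝒜) (bA : Module.Basis (ι ⊕ κ) K A)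
    (hu : ∀ i, bA (Sum.inl i) ∈ 𝒜 0) (hv : ∀ i, bA (Sum.inr i) ∈ 𝒜 1) {a : A} (ha : a ∈ 𝒜 1)
    (i : ι) : bA.coord (Sum.inl i) a = 0 := by
  have h : bA.coord (Sum.inl i) ∘ₗ parity hA = bA.coord (Sum.inl i) := by
    refine bA.ext ?_
    rintro (j | j)
    · simp [parity_even hA (hu j)]
    · simp [parity_odd hA (hv j)]
  have h' := LinearMap.congr_fun h a
  rw [LinearMap.comp_apply, parity_odd hA ha, map_neg] at h'
  exact self_eq_neg.1 h'.symm

theorem tensorCoord_inl_mem [CharZero K] {ι κ : Type*} [AddCommGroup A] [Module K A]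
    [AddCommGroup X] [Module K X]
    {𝒜 : ZMod 2 → Submodule K A} (hA : IsZ2Decomp K 𝒜) (bA : Module.Basis (ι ⊕ κ) K A)
    (hu : ∀ i, bA (Sum.inl i) ∈ 𝒜 0) (hv : ∀ i, bA (Sum.inr i) ∈ 𝒜 1)
    (𝒳 : ZMod 2 → Submodule K X) (i : ι) {k : ZMod 2} {y : A ⊗[K] X}
    (hy : y ∈ superTensorGrading K 𝒜 𝒳 k) : tensorCoord bA X (Sum.inl i) y ∈ 𝒳 k := by
  revert y
  change superTensorGrading K 𝒜 𝒳 k ≤ (𝒳 k).comap (tensorCoord bA X (Sum.inl i))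
  refine superTensorGrading_le fun l j hlj a ha x hx => ?_
  rw [Submodule.mem_comap, tensorCoord_tmul]
  fin_cases l
  · obtain rfl : j = k := (zero_add j).symm.trans hlj
    exact Submodule.smul_mem _ _ hx
  · rw [coord_inl_eq_zero hA bA hu hv ha, zero_smul]
    exact Submodule.zero_mem _

theorem tensorCoord_inr_mem [CharZero K] {ι κ : Type*} [AddCommGroup A] [Module K A]
    [AddCommGroup X] [Module K X]
    {𝒜 : ZMod 2 → Submodule K A} (hA : IsZ2Decomp K 𝒜) (bA : Module.Basis (ι ⊕ κ) K A)
    (hu : ∀ i, bA (Sum.inl i) ∈ 𝒜 0) (hv : ∀ i, bA (Sum.inr i) ∈ 𝒜 1)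
    (𝒳 : ZMod 2 → Submodule K X) (i : κ) {k : ZMod 2} {y : A ⊗[K] X}
    (hy : y ∈ superTensorGrading K 𝒜 𝒳 k) : tensorCoord bA X (Sum.inr i) y ∈ 𝒳 (k + 1) := by
  revert y
  change superTensorGrading K 𝒜 𝒳 k ≤ (𝒳 (k + 1)).comap (tensorCoord bA X (Sum.inr i))
  refine superTensorGrading_le fun l j hlj a ha x hx => ?_
  rw [Submodule.mem_comap, tensorCoord_tmul]
  fin_cases l
  · rw [coord_inr_eq_zero hA bA hu hv ha, zero_smul]
    exact Submodule.zero_mem _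
  · obtain rfl : j = k + 1 := by
      rw [← hlj]
      exact (ZMod.one_add_add_one j).symm
    exact Submodule.smul_mem _ _ hx

end SuperTensor

section Exterior

variable {K : Type u} [Field K] {V : Type*} [AddCommGroup V] [Module K V]

theorem ExteriorAlgebra.ι_mul_ι_neg (v w : V) :
    ExteriorAlgebra.ι K v * ExteriorAlgebra.ι K w =
      -(ExteriorAlgebra.ι K w * ExteriorAlgebra.ι K v) :=
  eq_neg_of_add_eq_zero_left (ExteriorAlgebra.ι_add_mul_swap v w)

theorem ExteriorAlgebra.commute_ι_mul_ι (v w : V) (y : ExteriorAlgebra K V) :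
    Commute (ExteriorAlgebra.ι K v * ExteriorAlgebra.ι K w) y := by
  induction y using ExteriorAlgebra.induction with
  | algebraMap r => exact Algebra.commute_algebraMap_right r _
  | ι z =>
    rw [Commute, SemiconjBy, mul_assoc, ExteriorAlgebra.ι_mul_ι_neg w z, mul_neg, ← mul_assoc,
      ExteriorAlgebra.ι_mul_ι_neg v z, neg_mul, neg_neg, mul_assoc]
  | mul a b ha hb => exact ha.mul_right hb
  | add a b ha hb => exact ha.add_right hb

theorem ExteriorAlgebra.commute_of_even {x : ExteriorAlgebra K V}
    (hx : x ∈ exteriorGrading K V 0) (y : ExteriorAlgebra K V) : Commute x y := by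
  induction x, hx using CliffordAlgebra.even_induction with
  | algebraMap r => exact Algebra.commute_algebraMap_left r _
  | add a b _ _ ha hb => exact ha.add_left hb
  | ι_mul_ι_mul v w x _ hx => exact (ExteriorAlgebra.commute_ι_mul_ι v w y).mul_left hx

theorem ExteriorAlgebra.ι_mul_odd (v : V) {x : ExteriorAlgebra K V}
    (hx : x ∈ exteriorGrading K V 1) :
    ExteriorAlgebra.ι K v * x = -(x * ExteriorAlgebra.ι K v) := by
  induction x, hx using CliffordAlgebra.odd_induction with
  | ι w => exact ExteriorAlgebra.ι_mul_ι_neg v w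
  | add a b _ _ ha hb => rw [mul_add, add_mul, ha, hb, neg_add]
  | ι_mul_ι_mul m n x _ hx =>
    have h := (ExteriorAlgebra.commute_ι_mul_ι m n (ExteriorAlgebra.ι K v)).eq
    change ExteriorAlgebra.ι K v * (ExteriorAlgebra.ι K m * ExteriorAlgebra.ι K n * x) =
      -(ExteriorAlgebra.ι K m * ExteriorAlgebra.ι K n * x * ExteriorAlgebra.ι K v)
    rw [← mul_assoc, ← h, mul_assoc, hx, mul_neg, mul_assoc _ x]

theorem ExteriorAlgebra.odd_mul_odd {x y : ExteriorAlgebra K V}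
    (hx : x ∈ exteriorGrading K V 1) (hy : y ∈ exteriorGrading K V 1) :
    x * y = -(y * x) := by
  induction x, hx using CliffordAlgebra.odd_induction with
  | ι w => exact ExteriorAlgebra.ι_mul_odd w hy
  | add a b _ _ ha hb => rw [mul_add, add_mul, ha, hb, neg_add]
  | ι_mul_ι_mul m n x _ hx =>
    have h := (ExteriorAlgebra.commute_ι_mul_ι m n y).eq
    change ExteriorAlgebra.ι K m * ExteriorAlgebra.ι K n * x * y =
      -(y * (ExteriorAlgebra.ι K m * ExteriorAlgebra.ι K n * x))
    rw [mul_assoc, hx, ← mul_assoc y, ← h, mul_neg, mul_assoc _ y]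

theorem exteriorGrading_isZ2Grading : IsZ2Grading K (exteriorGrading K V) := by
  have h := CliffordAlgebra.evenOdd_isCompl (Q := (0 : QuadraticForm K V))
  refine ⟨⟨h.sup_eq_top, h.inf_eq_bot⟩, ?_, fun i j x hx y hy => ?_⟩
  · exact CliffordAlgebra.one_le_evenOdd_zero _ (Submodule.one_le.1 le_rfl)
  · exact CliffordAlgebra.evenOdd_mul_le _ i j (Submodule.mul_mem_mul hx hy)

theorem exteriorGrading_isSupercommutative :
    IsSupercommutative K (exteriorGrading K V) := by
  intro i j x hx y hy
  obtain rfl | rfl := ZMod.eq_zero_or_eq_one i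
  · simpa using (ExteriorAlgebra.commute_of_even hx y).eq
  · obtain rfl | rfl := ZMod.eq_zero_or_eq_one j
    · simpa using (ExteriorAlgebra.commute_of_even hy x).eq.symm
    · simpa [ZMod.val_one] using! ExteriorAlgebra.odd_mul_odd hx hy

end Exterior

section FreeSuperLemmas

variable {K : Type u} [Field K]

theorem trivialEvenGrading_zero {P : Type*} [AddCommGroup P] [Module K P] :
    trivialEvenGrading K P 0 = ⊤ :=
  if_pos rfl

theorem trivialEvenGrading_one {P : Type*} [AddCommGroup P] [Module K P] :
    trivialEvenGrading K P 1 = ⊥ :=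
  if_neg one_ne_zero

theorem eq_zero_of_mem_trivialEvenGrading_one {P : Type*} [AddCommGroup P] [Module K P] {p : P}
    (hp : p ∈ trivialEvenGrading K P 1) : p = 0 := by
  rwa [trivialEvenGrading_one, Submodule.mem_bot] at hp

theorem trivialEvenGrading_isZ2Grading {P : Type*} [Ring P] [Algebra K P] :
    IsZ2Grading K (trivialEvenGrading K P) := by
  refine ⟨⟨?_, ?_⟩, ?_, fun i j x hx y hy => ?_⟩
  · rw [trivialEvenGrading_zero, top_sup_eq]
  · rw [trivialEvenGrading_one, inf_bot_eq]
  · rw [trivialEvenGrading_zero]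
    exact Submodule.mem_top
  · obtain rfl | rfl := ZMod.eq_zero_or_eq_one i
    · obtain rfl | rfl := ZMod.eq_zero_or_eq_one j
      · rw [add_zero, trivialEvenGrading_zero]
        exact Submodule.mem_top
      · simp [eq_zero_of_mem_trivialEvenGrading_one hy]
    · simp [eq_zero_of_mem_trivialEvenGrading_one hx]

theorem freeSuperGrading_isZ2Grading [CharZero K] (ι : Type*) :
    IsZ2Grading K (freeSuperGrading K ι) :=
  superTensorGrading_isZ2Grading trivialEvenGrading_isZ2Grading exteriorGrading_isZ2Grading

theorem freeSuperGrading_le {ι : Type*} {k : ZMod 2}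
    {W : Submodule K (FreeSuperAlgebra K ι)}
    (h : ∀ p, ∀ x ∈ exteriorGrading K (ι →₀ K) k, p ⊗ₜ[K] x ∈ W) :
    freeSuperGrading K ι k ≤ W := by
  refine superTensorGrading_le fun i j hij p hp x hx => ?_
  fin_cases i
  · obtain rfl : j = k := (zero_add j).symm.trans hij
    exact h p x hx
  · rw [eq_zero_of_mem_trivialEvenGrading_one hp, TensorProduct.zero_tmul]
    exact W.zero_mem

theorem freeSuperGrading_isSupercommutative (ι : Type*) :
    IsSupercommutative K (freeSuperGrading K ι) := by
  intro k l y hy z hz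
  revert y
  change freeSuperGrading K ι k ≤ LinearMap.eqLocus (LinearMap.mulRight K z)
    ((-1 : K) ^ (k.val * l.val) • LinearMap.mulLeft K z)
  refine freeSuperGrading_le fun p x hx => ?_
  change p ⊗ₜ[K] x * z = (-1 : K) ^ (k.val * l.val) • (z * p ⊗ₜ[K] x)
  revert z
  change freeSuperGrading K ι l ≤ LinearMap.eqLocus (LinearMap.mulLeft K (p ⊗ₜ[K] x))
    ((-1 : K) ^ (k.val * l.val) • LinearMap.mulRight K (p ⊗ₜ[K] x))
  refine freeSuperGrading_le fun q w hw => ?_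
  change p ⊗ₜ[K] x * q ⊗ₜ[K] w = (-1 : K) ^ (k.val * l.val) • (q ⊗ₜ[K] w * p ⊗ₜ[K] x)
  rw [Algebra.TensorProduct.tmul_mul_tmul, Algebra.TensorProduct.tmul_mul_tmul,
    exteriorGrading_isSupercommutative k l x hx w hw, TensorProduct.tmul_smul, mul_comm p q]

theorem sGen_mem {ι : Type*} (p : ι) : sGen K p ∈ freeSuperGrading K ι 0 := by
  have hp : MvPolynomial.X p ∈ trivialEvenGrading K (MvPolynomial ι K) 0 := by
    rw [trivialEvenGrading_zero]
    exact Submodule.mem_top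
  have hx : (1 : ExteriorAlgebra K (ι →₀ K)) ∈ exteriorGrading K (ι →₀ K) 0 :=
    (exteriorGrading_isZ2Grading (V := ι →₀ K)).2.1
  exact tmul_mem_superTensorGrading hp hx (add_zero 0)

theorem tGen_mem {ι : Type*} (p : ι) : tGen K p ∈ freeSuperGrading K ι 1 := by
  have hp : 1 ∈ trivialEvenGrading K (MvPolynomial ι K) 0 := by
    rw [trivialEvenGrading_zero]
    exact Submodule.mem_top
  have hx : ExteriorAlgebra.ι K (Finsupp.single p 1) ∈ exteriorGrading K (ι →₀ K) 1 :=
    CliffordAlgebra.ι_mem_evenOdd_one (0 : QuadraticForm K (ι →₀ K)) _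
  exact tmul_mem_superTensorGrading hp hx (zero_add 1)

theorem IsSupercommutative.commute_of_even {F : Type*} [Ring F] [Algebra K F]
    {ℱ : ZMod 2 → Submodule K F} (hd : IsZ2Decomp K ℱ) (hF : IsSupercommutative K ℱ) {x : F}
    (hx : x ∈ ℱ 0) (y : F) : Commute x y := by
  obtain ⟨y₀, hy₀, y₁, hy₁, rfl⟩ := hd.exists_add y
  refine Commute.add_right ?_ ?_
  · simpa using! hF 0 0 x hx y₀ hy₀
  · simpa using! hF 0 1 x hx y₁ hy₁

theorem IsSupercommutative.mul_self_of_odd [CharZero K] {F : Type*} [Ring F] [Algebra K F]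
    {ℱ : ZMod 2 → Submodule K F} (hF : IsSupercommutative K ℱ) {x : F}
    (hx : x ∈ ℱ 1) : x * x = 0 := by
  have h : x * x = -(x * x) := by simpa [ZMod.val_one] using hF 1 1 x hx x hx
  have h2 : (2 : K) • (x * x) = 0 := by rw [two_smul]; nth_rw 2 [h]; simp
  simpa using h2

/-- The universal property of the free supercommutative algebra. -/
theorem FreeSuperAlgebra.exists_lift [CharZero K] {ι : Type*} {F : Type*} [Ring F] [Algebra K F]
    {ℱ : ZMod 2 → Submodule K F} (hg : IsZ2Grading K ℱ) (hF : IsSupercommutative K ℱ)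
    {s t : ι → F} (hs : ∀ p, s p ∈ ℱ 0) (ht : ∀ p, t p ∈ ℱ 1) :
    ∃ ζ : FreeSuperAlgebra K ι →ₐ[K] F, (∀ p, ζ (sGen K p) = s p) ∧
      (∀ p, ζ (tGen K p) = t p) ∧ IsGradedHom K (freeSuperGrading K ι) ℱ ζ := by
  have hsc p : s p ∈ Subalgebra.center K F :=
    Subalgebra.mem_center_iff.2 fun y => (hF.commute_of_even hg.1 (hs p) y).eq.symm
  let f : MvPolynomial ι K →ₐ[K] F := (Subalgebra.center K F).val.comp
    (MvPolynomial.aeval fun p => (⟨s p, hsc p⟩ : Subalgebra.center K F))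
  have hf p : f (MvPolynomial.X p) = s p := by simp [f]
  have hf0 q : f q ∈ ℱ 0 := by
    induction q using MvPolynomial.induction_on with
    | C r =>
      rw [← MvPolynomial.algebraMap_eq, AlgHom.commutes, Algebra.algebraMap_eq_smul_one]
      exact Submodule.smul_mem _ _ hg.2.1
    | add p q hp hq => rw [map_add]; exact Submodule.add_mem _ hp hq
    | mul_X p i hp => rw [map_mul, hf]; exact hg.2.2 0 0 _ hp _ (hs i)
  let l : (ι →₀ K) →ₗ[K] F := Finsupp.linearCombination K t
  have hl1 v : l v ∈ ℱ 1 :=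
    Submodule.sum_mem _ fun i _ => Submodule.smul_mem _ _ (ht i)
  let g : ExteriorAlgebra K (ι →₀ K) →ₐ[K] F :=
    ExteriorAlgebra.lift K ⟨l, fun v => hF.mul_self_of_odd (hl1 v)⟩
  have hgι v : g (ExteriorAlgebra.ι K v) = l v := ExteriorAlgebra.lift_ι_apply _ _ _ _
  have hgk (k : ZMod 2) x (hx : x ∈ exteriorGrading K (ι →₀ K) k) : g x ∈ ℱ k := by
    fin_cases k
    · induction x, hx using CliffordAlgebra.even_induction with
      | algebraMap r =>
        change g (algebraMap K (ExteriorAlgebra K (ι →₀ K)) r) ∈ ℱ 0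
        rw [AlgHom.commutes, Algebra.algebraMap_eq_smul_one]
        exact Submodule.smul_mem _ _ hg.2.1
      | add x y _ _ hx hy => rw [map_add]; exact Submodule.add_mem _ hx hy
      | ι_mul_ι_mul v w x _ hx =>
        change g (ExteriorAlgebra.ι K v * ExteriorAlgebra.ι K w * x) ∈ ℱ 0
        rw [map_mul, map_mul, hgι, hgι]
        exact hg.2.2 0 0 _ (hg.2.2 1 1 _ (hl1 v) _ (hl1 w)) _ hx
    · induction x, hx using CliffordAlgebra.odd_induction with
      | ι v =>
        change g (ExteriorAlgebra.ι K v) ∈ ℱ 1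
        rw [hgι]
        exact hl1 v
      | add x y _ _ hx hy => rw [map_add]; exact Submodule.add_mem _ hx hy
      | ι_mul_ι_mul v w x _ hx =>
        change g (ExteriorAlgebra.ι K v * ExteriorAlgebra.ι K w * x) ∈ ℱ 1
        rw [map_mul, map_mul, hgι, hgι]
        exact hg.2.2 0 1 _ (hg.2.2 1 1 _ (hl1 v) _ (hl1 w)) _ hx
  have hcomm q x : Commute (f q) (g x) := hF.commute_of_even hg.1 (hf0 q) _
  refine ⟨Algebra.TensorProduct.lift f g hcomm, fun p => ?_, fun p => ?_, fun k => ?_⟩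
  · simp [sGen, hf]
  · simp [tGen, hgι, l]
  · change freeSuperGrading K ι k ≤
      (ℱ k).comap (Algebra.TensorProduct.lift f g hcomm).toLinearMap
    refine freeSuperGrading_le fun p x hx => ?_
    change Algebra.TensorProduct.lift f g hcomm (p ⊗ₜ x) ∈ ℱ k
    rw [Algebra.TensorProduct.lift_tmul, ← zero_add k]
    exact hg.2.2 0 k _ (hf0 p) _ (hgk k x hx)

end FreeSuperLemmas

section CentralSimple

variable {K : Type u} [Field K] {A : Type*} [Ring A] [Algebra K A]

/-- A graded-simple algebra with trivial center has no proper two-sided ideals at all. -/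
theorem IsGradedSimple.eq_bot_or_eq_top [CharZero K] {𝒜 : ZMod 2 → Submodule K A}
    (h𝒜 : IsZ2Grading K 𝒜) (hsimple : IsGradedSimple K 𝒜)
    (hcentral : Subalgebra.center K A = ⊥) {I : Submodule K A} (hI : IsTwoSidedSubmodule K I) :
    I = ⊥ ∨ I = ⊤ := by
  set J : Submodule K A := I.comap (parity h𝒜.1) with hJ
  have hJ2 : IsTwoSidedSubmodule K J := fun a x hx =>
    ⟨by rw [hJ, Submodule.mem_comap, parity_mul h𝒜]; exact (hI _ _ hx).1,
      by rw [hJ, Submodule.mem_comap, parity_mul h𝒜]; exact (hI _ _ hx).2⟩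
  have hIJ x (hx : x ∈ I) : parity h𝒜.1 x ∈ J := by
    rwa [hJ, Submodule.mem_comap, parity_parity]
  have hinf := hsimple (I ⊓ J) (fun a x hx => ⟨⟨(hI a x hx.1).1, (hJ2 a x hx.2).1⟩,
      ⟨(hI a x hx.1).2, (hJ2 a x hx.2).2⟩⟩)
    (isGradedSubmodule_of_parity_mem h𝒜.1 fun x hx => ⟨hx.2, hIJ x hx.1⟩)
  have hsup := hsimple (I ⊔ J)
    (fun a x hx => by
      obtain ⟨y, hy, z, hz, rfl⟩ := Submodule.mem_sup.1 hx
      rw [mul_add, add_mul]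
      exact ⟨Submodule.add_mem_sup (hI a y hy).1 (hJ2 a z hz).1,
        Submodule.add_mem_sup (hI a y hy).2 (hJ2 a z hz).2⟩)
    (isGradedSubmodule_of_parity_mem h𝒜.1 fun x hx => by
      obtain ⟨y, hy, z, hz, rfl⟩ := Submodule.mem_sup.1 hx
      rw [map_add, add_comm]
      exact Submodule.add_mem_sup hz (hIJ y hy))
  rcases hinf with hinf | hinf
  swap
  · exact Or.inr (top_le_iff.1 (hinf ▸ inf_le_left))
  rcases hsup with hsup | hsup
  · exact Or.inl (le_bot_iff.1 (hsup ▸ le_sup_left))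
  have hzero {x} (hx : x ∈ I) (hx' : x ∈ J) : x = 0 :=
    (Submodule.mem_bot K).1 (hinf ▸ ⟨hx, hx'⟩)
  obtain ⟨e, he, f, hf, hef⟩ :=
    Submodule.mem_sup.1 (hsup.symm ▸ Submodule.mem_top : (1 : A) ∈ I ⊔ J)
  have hec : e ∈ Subalgebra.center K A := by
    refine Subalgebra.mem_center_iff.2 fun x => ?_
    obtain ⟨y, hy, z, hz, rfl⟩ :=
      Submodule.mem_sup.1 (hsup.symm ▸ Submodule.mem_top : x ∈ I ⊔ J)
    have h1 : y * e = y := by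
      conv_rhs => rw [← mul_one y, ← hef, mul_add, hzero (hI f y hy).2 (hJ2 y f hf).1, add_zero]
    have h2 : e * y = y := by
      conv_rhs => rw [← one_mul y, ← hef, add_mul, hzero (hI f y hy).1 (hJ2 y f hf).2, add_zero]
    have h3 : z * e = 0 := hzero (hI z e he).1 (hJ2 e z hz).2
    have h4 : e * z = 0 := hzero (hI z e he).2 (hJ2 e z hz).1
    rw [add_mul, mul_add, h1, h2, h3, h4]
  rw [hcentral] at hec
  obtain ⟨c, rfl⟩ := Algebra.mem_bot.1 hec
  have htop {W : Submodule K A} (hW : IsTwoSidedSubmodule K W) (h1 : (1 : A) ∈ W) : W = ⊤ :=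
    eq_top_iff.2 fun x _ => by simpa using (hW x 1 h1).1
  rcases eq_or_ne c 0 with rfl | hc
  · left
    rw [map_zero, zero_add] at hef
    rw [htop hJ2 (hef ▸ hf), inf_top_eq] at hinf
    exact hinf
  · right
    refine htop hI ?_
    have := I.smul_mem c⁻¹ he
    rwa [Algebra.algebraMap_eq_smul_one, smul_smul, inv_mul_cancel₀ hc, one_smul] at this

/-- Every linear endomorphism of a finite-dimensional central simple algebra is a sum of
two-sided multiplications. -/
theorem mulLeftRight_surjective [FiniteDimensional K A] [Nontrivial A]
    (hcentral : Subalgebra.center K A = ⊥)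
    (hsimple : ∀ I : Submodule K A, IsTwoSidedSubmodule K I → I = ⊥ ∨ I = ⊤) :
    Function.Surjective (AlgHom.mulLeftRight K A) := by
  intro g
  let R := (AlgHom.mulLeftRight K A).range
  have hmul (a b : A) : ∃ r : R, ∀ x : A, r • x = a * x * b :=
    ⟨⟨_, AlgHom.mem_range_self _ (a ⊗ₜ MulOpposite.op b)⟩, fun x => by
      simp [Subalgebra.smul_def]⟩
  have : IsSimpleModule R A := by
    refine (isSimpleModule_iff R A).2
      { exists_pair_ne := ⟨⊥, ⊤, bot_ne_top⟩, eq_bot_or_eq_top := ?_ }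
    intro N
    have h := hsimple (N.restrictScalars K) fun a x hx => by
      obtain ⟨r, hr⟩ := hmul a 1
      obtain ⟨s, hs⟩ := hmul 1 a
      refine ⟨?_, ?_⟩
      · simpa [hr] using N.smul_mem r hx
      · simpa [hs] using N.smul_mem s hx
    simpa using h
  have hend (φ : Module.End R A) : ∃ c : K, ∀ x, φ x = c • x := by
    have h1 (x : A) : φ x = x * φ 1 := by
      obtain ⟨r, hr⟩ := hmul x 1
      simpa [hr] using φ.map_smul r 1
    have h2 (x : A) : φ x = φ 1 * x := by
      obtain ⟨r, hr⟩ := hmul 1 x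
      simpa [hr] using φ.map_smul r 1
    have hc : φ 1 ∈ Subalgebra.center K A :=
      Subalgebra.mem_center_iff.2 fun x => (h1 x).symm.trans (h2 x)
    rw [hcentral] at hc
    obtain ⟨c, hc⟩ := Algebra.mem_bot.1 hc
    exact ⟨c, fun x => by rw [h2, ← hc, Algebra.smul_def]⟩
  let g' : Module.End (Module.End R A) A :=
    { toFun := g
      map_add' := g.map_add
      map_smul' := fun φ x => by
        obtain ⟨c, hc⟩ := hend φ
        simp [hc] }
  obtain ⟨s, hs⟩ := Module.Finite.fg_top (R := K) (M := A)
  obtain ⟨⟨r, T, rfl⟩, hr⟩ := jacobson_density (R := R) (M := A) g' s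
  refine ⟨T, LinearMap.ext_on hs fun x hx => (hr x hx).symm⟩

theorem rTensor_mulLeftRight_mem {X : Type*} [Ring X] [Algebra K X]
    {I : Submodule K (A ⊗[K] X)} (hI : IsTwoSidedSubmodule K I) (T : A ⊗[K] Aᵐᵒᵖ)
    {y : A ⊗[K] X} (hy : y ∈ I) : (AlgHom.mulLeftRight K A T).rTensor X y ∈ I := by
  induction T with
  | zero => simp
  | add S T hS hT =>
    rw [map_add, LinearMap.rTensor_add]
    exact I.add_mem hS hT
  | tmul a b =>
    have : (AlgHom.mulLeftRight K A (a ⊗ₜ b)).rTensor X y =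
        a ⊗ₜ 1 * y * MulOpposite.unop b ⊗ₜ 1 := by
      clear hy
      induction y with
      | zero => simp
      | add y z hy hz => rw [map_add, hy, hz, mul_add, add_mul]
      | tmul c x => simp
    rw [this]
    exact (hI _ _ (hI _ _ hy).1).2

theorem one_tmul_tensorCoord_mem {ι X : Type*} [Ring X] [Algebra K X] (bA : Module.Basis ι K A)
    (hsurj : Function.Surjective (AlgHom.mulLeftRight K A))
    {I : Submodule K (A ⊗[K] X)} (hI : IsTwoSidedSubmodule K I) {y : A ⊗[K] X} (hy : y ∈ I)
    (i : ι) : (1 : A) ⊗ₜ[K] tensorCoord bA X i y ∈ I := by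
  obtain ⟨T, hT⟩ := hsurj ((bA.coord i).smulRight 1)
  have h := rTensor_mulLeftRight_mem hI T hy
  rw [hT] at h
  convert h using 1
  clear h hy
  induction y with
  | zero => simp
  | add y z hy hz => simp only [map_add, TensorProduct.tmul_add, hy, hz]
  | tmul a x => simp [TensorProduct.smul_tmul]

end CentralSimple

section Quotient

variable {K : Type u} [Field K]

/-- The quotient of a supercommutative algebra by a graded two-sided ideal. -/
theorem exists_superAlg_quotient {D : Type u} [Ring D] [Algebra K D]
    {𝒟 : ZMod 2 → Submodule K D} (hg : IsZ2Grading K 𝒟) (hs : IsSupercommutative K 𝒟)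
    {J : Submodule K D} (hJ : IsTwoSidedSubmodule K J)
    (hgr : ∀ y ∈ 𝒟 0, ∀ z ∈ 𝒟 1, y + z ∈ J → y ∈ J) :
    ∃ (F : SuperAlg K) (π : D →ₐ[K] F.carrier), IsGradedHom K 𝒟 F.grading π ∧
      ∀ d, π d = 0 ↔ d ∈ J := by
  let I : Ideal D :=
    { J.toAddSubmonoid with smul_mem' := fun a x hx => (hJ a x hx).1 }
  have : I.IsTwoSided := ⟨fun b hx => (hJ b _ hx).2⟩
  let π : D →ₐ[K] D ⧸ I := Ideal.Quotient.mkₐ K I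
  have hπ : Function.Surjective π := Ideal.Quotient.mkₐ_surjective K I
  have hker (d : D) : π d = 0 ↔ d ∈ J := Ideal.Quotient.eq_zero_iff_mem
  let 𝒬 (k : ZMod 2) : Submodule K (D ⧸ I) := (𝒟 k).map π.toLinearMap
  have hmem (k : ZMod 2) (d : D) (hd : d ∈ 𝒟 k) : π d ∈ 𝒬 k := ⟨d, hd, rfl⟩
  have hgrading : IsZ2Grading K 𝒬 := by
    refine ⟨⟨?_, ?_⟩, ?_, ?_⟩
    · refine eq_top_iff.2 fun x _ => ?_
      obtain ⟨d, rfl⟩ := hπ x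
      obtain ⟨y, hy, z, hz, rfl⟩ := hg.1.exists_add d
      rw [map_add]
      exact Submodule.add_mem_sup (hmem 0 y hy) (hmem 1 z hz)
    · refine (Submodule.eq_bot_iff _).2 ?_
      rintro _ ⟨⟨y, hy, rfl⟩, ⟨z, hz, hyz⟩⟩
      refine (hker y).2 (hgr y hy (-z) (Submodule.neg_mem _ hz) ((hker _).1 ?_))
      rw [map_add, map_neg]
      exact add_neg_eq_zero.2 hyz.symm
    · exact map_one π ▸ hmem 0 1 hg.2.1
    · rintro i j _ ⟨y, hy, rfl⟩ _ ⟨z, hz, rfl⟩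
      change π y * π z ∈ 𝒬 (i + j)
      rw [← map_mul]
      exact hmem _ _ (hg.2.2 i j y hy z hz)
  have hsuper : IsSupercommutative K 𝒬 := by
    rintro i j _ ⟨y, hy, rfl⟩ _ ⟨z, hz, rfl⟩
    change π y * π z = (-1 : K) ^ (i.val * j.val) • (π z * π y)
    rw [← map_mul, ← map_mul, ← map_smul, hs i j y hy z hz]
  exact ⟨⟨D ⧸ I, 𝒬, hgrading, hsuper⟩, π, hmem, hker⟩

end Quotient

section TwoSidedSpan

variable {K : Type u} [Field K] {C : Type*} [Ring C] [Algebra K C]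

theorem subset_twoSidedSpan (s : Set C) : s ⊆ twoSidedSpan K s := fun _ hx =>
  Submodule.mem_sInf.2 fun _ hI => hI.2 hx

theorem twoSidedSpan_le {s : Set C} {I : Submodule K C} (hI : IsTwoSidedSubmodule K I)
    (hs : s ⊆ I) : twoSidedSpan K s ≤ I :=
  sInf_le ⟨hI, hs⟩

theorem isTwoSidedSubmodule_twoSidedSpan (s : Set C) :
    IsTwoSidedSubmodule K (twoSidedSpan K s) := fun a x hx =>
  ⟨Submodule.mem_sInf.2 fun I hI => (hI.1 a x (Submodule.mem_sInf.1 hx I hI)).1,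
    Submodule.mem_sInf.2 fun I hI => (hI.1 a x (Submodule.mem_sInf.1 hx I hI)).2⟩

theorem isTwoSidedSubmodule_ker {C' : Type*} [Ring C'] [Algebra K C'] (f : C →ₐ[K] C') :
    IsTwoSidedSubmodule K (LinearMap.ker f.toLinearMap) := fun a x hx => by
  have hx : f x = 0 := hx
  exact ⟨show f (a * x) = 0 by simp [hx], show f (x * a) = 0 by simp [hx]⟩

theorem parity_mem_twoSidedSpan {𝒞 : ZMod 2 → Submodule K C} (h : IsZ2Grading K 𝒞) {s : Set C}
    (hs : ∀ x ∈ s, parity h.1 x ∈ s) :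
    ∀ x ∈ twoSidedSpan K s, parity h.1 x ∈ twoSidedSpan K s := by
  have hI := isTwoSidedSubmodule_twoSidedSpan (K := K) s
  refine twoSidedSpan_le (I := (twoSidedSpan K s).comap (parity h.1)) (fun a x hx => ?_)
    fun x hx => subset_twoSidedSpan s (hs x hx)
  rw [Submodule.mem_comap, Submodule.mem_comap, parity_mul h, parity_mul h]
  exact hI _ _ hx

theorem parity_mem_adjoin {𝒞 : ZMod 2 → Submodule K C} (h : IsZ2Grading K 𝒞) {s : Set C}
    (hs : ∀ x ∈ s, x ∈ 𝒞 0 ∨ x ∈ 𝒞 1) :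
    ∀ x ∈ Algebra.adjoin K s, parity h.1 x ∈ Algebra.adjoin K s := by
  intro x hx
  induction hx using Algebra.adjoin_induction with
  | mem x hx =>
    have hx' := Algebra.subset_adjoin (R := K) hx
    rcases hs x hx with h0 | h1
    · rwa [parity_even h.1 h0]
    · rw [parity_odd h.1 h1]
      exact neg_mem hx'
  | algebraMap r =>
    rw [Algebra.algebraMap_eq_smul_one, map_smul, parity_even h.1 h.2.1,
      ← Algebra.algebraMap_eq_smul_one]
    exact Subalgebra.algebraMap_mem _ r
  | add x y _ _ hx hy => rw [map_add]; exact add_mem hx hy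
  | mul x y _ _ hx hy => rw [parity_mul h]; exact mul_mem hx hy

end TwoSidedSpan

section AlgHomFactor

variable {K B C E : Type*} [CommRing K] [Ring B] [Algebra K B] [Ring C] [Algebra K C] [Semiring E]
  [Algebra K E]

theorem AlgHom.exists_comp_eq_of_injective (κ : B →ₐ[K] C) (hκ : Function.Injective κ)
    (f : E →ₐ[K] C) (hf : ∀ x, f x ∈ κ.range) : ∃ φ : E →ₐ[K] B, ∀ x, κ (φ x) = f x := by
  refine ⟨(AlgEquiv.ofInjective κ hκ).symm.toAlgHom.comp (f.codRestrict κ.range hf), fun x => ?_⟩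
  exact congrArg Subtype.val
    ((AlgEquiv.ofInjective κ hκ).apply_symm_apply (f.codRestrict κ.range hf x))

theorem AlgHom.exists_comp_eq_of_surjective (φ : E →ₐ[K] B) (hφ : Function.Surjective φ)
    (f : E →ₐ[K] C) (hf : ∀ x, φ x = 0 → f x = 0) : ∃ κ : B →ₐ[K] C, ∀ x, κ (φ x) = f x := by
  have hf' {x y : E} (h : φ x = φ y) : f x = f y := by
    simpa [sub_eq_zero, ← sub_eq_add_neg] using hf (x + (-1 : K) • y) (by simp [h])
  let σ := Function.surjInv hφ
  have hσ (c : B) : φ (σ c) = c := Function.surjInv_eq hφ c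
  refine ⟨AlgHom.ofLinearMap
    { toFun := fun c => f (σ c)
      map_add' := fun c d => by rw [← map_add]; exact hf' (by simp [hσ])
      map_smul' := fun r c => by
        rw [RingHom.id_apply, ← map_smul]
        exact hf' (by simp [hσ]) } ?_ ?_, fun x => hf' (hσ _)⟩
  · exact (hf' (by simp [hσ])).trans (map_one f)
  · intro c d
    exact (hf' (by simp [hσ])).trans (map_mul f (σ c) (σ d))

end AlgHomFactor

theorem IsGradedHom.mem_of_injective {K : Type u} [Field K] {B C : Type*} [Ring B] [Algebra K B]
    [Ring C] [Algebra K C] {ℬ : ZMod 2 → Submodule K B} {𝒞 : ZMod 2 → Submodule K C}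
    (hB : IsZ2Decomp K ℬ) (hC : IsZ2Decomp K 𝒞) {κ : B →ₐ[K] C} (hκ : IsGradedHom K ℬ 𝒞 κ)
    (hinj : Function.Injective κ) {k : ZMod 2} {b : B} (hb : κ b ∈ 𝒞 k) : b ∈ ℬ k := by
  obtain ⟨y, hy, z, hz, rfl⟩ := hB.exists_add' k b
  have hz' : κ z ∈ 𝒞 k := by
    rw [map_add] at hb
    exact ((𝒞 k).add_mem_iff_right (hκ k y hy)).1 hb
  have : z = 0 := hinj ((hC.eq_zero hz' (hκ _ z hz)).trans (map_zero κ).symm)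
  rwa [this, add_zero]

section Generic

variable {K : Type u} [Field K] {A : Type u} [Ring A] [Algebra K A]
  {𝒜 : ZMod 2 → Submodule K A} {a b : ℕ} {bA : Module.Basis (Fin a ⊕ Fin b) K A}

theorem genericX_mem (hu : ∀ i, bA (Sum.inl i) ∈ 𝒜 0) (hv : ∀ i, bA (Sum.inr i) ∈ 𝒜 1) (j : ℕ) :
    genericX K bA j ∈ superTensorGrading K 𝒜 (freeSuperGrading K ((Fin a ⊕ Fin b) × ℕ)) 0 :=
  Submodule.add_mem _
    (Submodule.sum_mem _ fun i _ => tmul_mem_superTensorGrading (hu i) (sGen_mem _) rfl)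
    (Submodule.sum_mem _ fun i _ => tmul_mem_superTensorGrading (hv i) (tGen_mem _) rfl)

theorem genericY_mem (hu : ∀ i, bA (Sum.inl i) ∈ 𝒜 0) (hv : ∀ i, bA (Sum.inr i) ∈ 𝒜 1) (j : ℕ) :
    genericY K bA j ∈ superTensorGrading K 𝒜 (freeSuperGrading K ((Fin a ⊕ Fin b) × ℕ)) 1 :=
  Submodule.add_mem _
    (Submodule.sum_mem _ fun i _ => tmul_mem_superTensorGrading (hu i) (tGen_mem _) rfl)
    (Submodule.sum_mem _ fun i _ => tmul_mem_superTensorGrading (hv i) (sGen_mem _) rfl)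

theorem genericX_or_genericY_mem (hu : ∀ i, bA (Sum.inl i) ∈ 𝒜 0)
    (hv : ∀ i, bA (Sum.inr i) ∈ 𝒜 1) :
    ∀ x ∈ Set.range (genericX K bA) ∪ Set.range (genericY K bA),
      x ∈ superTensorGrading K 𝒜 (freeSuperGrading K ((Fin a ⊕ Fin b) × ℕ)) 0 ∨
        x ∈ superTensorGrading K 𝒜 (freeSuperGrading K ((Fin a ⊕ Fin b) × ℕ)) 1 := by
  rintro _ (⟨j, rfl⟩ | ⟨j, rfl⟩)
  · exact Or.inl (genericX_mem hu hv j)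
  · exact Or.inr (genericY_mem hu hv j)

/-- The generic elements specialize to any sequences of even and odd elements of `A ⊗ F`. -/
theorem exists_generic_specialization [CharZero K] (h𝒜 : IsZ2Grading K 𝒜)
    (hu : ∀ i, bA (Sum.inl i) ∈ 𝒜 0) (hv : ∀ i, bA (Sum.inr i) ∈ 𝒜 1) (F : SuperAlg K)
    {x y : ℕ → A ⊗[K] F.carrier} (hx : ∀ j, x j ∈ superTensorGrading K 𝒜 F.grading 0)
    (hy : ∀ j, y j ∈ superTensorGrading K 𝒜 F.grading 1) :
    ∃ ζ : FreeSuperAlgebra K ((Fin a ⊕ Fin b) × ℕ) →ₐ[K] F.carrier,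
      IsGradedHom K (freeSuperGrading K _) F.grading ζ ∧
      (∀ j, Algebra.TensorProduct.map (AlgHom.id K A) ζ (genericX K bA j) = x j) ∧
      ∀ j, Algebra.TensorProduct.map (AlgHom.id K A) ζ (genericY K bA j) = y j := by
  let s (p : (Fin a ⊕ Fin b) × ℕ) : F.carrier :=
    tensorCoord bA F.carrier p.1 (p.1.elim (fun _ => x p.2) fun _ => y p.2)
  let t (p : (Fin a ⊕ Fin b) × ℕ) : F.carrier :=
    tensorCoord bA F.carrier p.1 (p.1.elim (fun _ => y p.2) fun _ => x p.2)
  have hs p : s p ∈ F.grading 0 := by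
    obtain ⟨i | i, j⟩ := p
    · exact tensorCoord_inl_mem h𝒜.1 bA hu hv F.grading i (hx j)
    · exact tensorCoord_inr_mem h𝒜.1 bA hu hv F.grading i (hy j)
  have ht p : t p ∈ F.grading 1 := by
    obtain ⟨i | i, j⟩ := p
    · exact tensorCoord_inl_mem h𝒜.1 bA hu hv F.grading i (hy j)
    · exact tensorCoord_inr_mem h𝒜.1 bA hu hv F.grading i (hx j)
  obtain ⟨ζ, hζs, hζt, hζ⟩ := FreeSuperAlgebra.exists_lift F.isGrading F.isSupercomm hs ht
  refine ⟨ζ, hζ, fun j => ?_, fun j => ?_⟩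
  · conv_rhs => rw [← sum_tmul_tensorCoord bA (x j), Fintype.sum_sum_type]
    simp [genericX, hζs, hζt, s, t]
  · conv_rhs => rw [← sum_tmul_tensorCoord bA (y j), Fintype.sum_sum_type]
    simp [genericY, hζs, hζt, s, t]

end Generic

section Embedding

theorem map_eq_zero_iff_mem {K : Type u} [Field K] {A : Type*} [Ring A] [Algebra K A]
    {ι X Y : Type*} [Fintype ι] [Ring X] [Algebra K X] [Ring Y] [Algebra K Y]
    (bA : Module.Basis ι K A) (hsurj : Function.Surjective (AlgHom.mulLeftRight K A))
    {I : Submodule K (A ⊗[K] X)} (hI : IsTwoSidedSubmodule K I) {π : X →ₐ[K] Y}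
    (hπ : ∀ d, π d = 0 ↔ (1 : A) ⊗ₜ[K] d ∈ I) (y : A ⊗[K] X) :
    Algebra.TensorProduct.map (AlgHom.id K A) π y = 0 ↔ y ∈ I := by
  refine ⟨fun h => ?_, fun h => ?_⟩
  · rw [← sum_tmul_tensorCoord bA y]
    refine I.sum_mem fun i _ => ?_
    have hi : (1 : A) ⊗ₜ[K] tensorCoord bA X i y ∈ I := by
      rw [← hπ, ← tensorCoord_map, h, map_zero]
    simpa using (hI (bA i ⊗ₜ 1) _ hi).1
  · rw [← sum_tmul_tensorCoord bA (Algebra.TensorProduct.map (AlgHom.id K A) π y)]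
    refine Finset.sum_eq_zero fun i _ => ?_
    rw [tensorCoord_map, (hπ _).2 (one_tmul_tensorCoord_mem bA hsurj hI h i),
      TensorProduct.tmul_zero]

variable {K : Type u} [Field K] [CharZero K] {A : Type u} [Ring A] [Algebra K A]
  {𝒜 : ZMod 2 → Submodule K A} {a b : ℕ} {bA : Module.Basis (Fin a ⊕ Fin b) K A}
  {B : Type u} [Ring B] [Algebra K B] {ℬ : ZMod 2 → Submodule K B}

theorem exists_generic_presentation_of_embedding (h𝒜 : IsZ2Grading K 𝒜)
    (hu : ∀ i, bA (Sum.inl i) ∈ 𝒜 0) (hv : ∀ i, bA (Sum.inr i) ∈ 𝒜 1) (hℬ : IsZ2Grading K ℬ)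
    {g : ℕ → B} (hg : ∀ n, g n ∈ ℬ 0 ∨ g n ∈ ℬ 1) (hgen : Algebra.adjoin K (Set.range g) = ⊤)
    (F : SuperAlg K) {κ : B →ₐ[K] A ⊗[K] F.carrier}
    (hκ : IsGradedHom K ℬ (superTensorGrading K 𝒜 F.grading) κ) (hinj : Function.Injective κ) :
    ∃ φ : genericSubalgebra K bA →ₐ[K] B, Function.Surjective φ ∧
      (∀ k, ∀ x : genericSubalgebra K bA,
        x.1 ∈ superTensorGrading K 𝒜 (freeSuperGrading K _) k → φ x ∈ ℬ k) ∧
      ∀ x : genericSubalgebra K bA,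
        x.1 ∈ twoSidedSpan K (Subtype.val '' {y : genericSubalgebra K bA | φ y = 0}) ↔
          φ x = 0 := by
  classical
  let g₀ (n : ℕ) : B := if g n ∈ ℬ 0 then g n else 0
  let g₁ (n : ℕ) : B := if g n ∈ ℬ 0 then 0 else g n
  have hg₀ n : g₀ n ∈ ℬ 0 := by
    by_cases h : g n ∈ ℬ 0 <;> simp [g₀, h]
  have hg₁ n : g₁ n ∈ ℬ 1 := by
    by_cases h : g n ∈ ℬ 0
    · simp [g₁, h]
    · simpa [g₁, h] using (hg n).resolve_left h
  obtain ⟨ζ, hζ, hX, hY⟩ := exists_generic_specialization (bA := bA) h𝒜 hu hv F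
    (fun j => hκ 0 _ (hg₀ j)) (fun j => hκ 1 _ (hg₁ j))
  set Φ := Algebra.TensorProduct.map (AlgHom.id K A) ζ
  have hle : genericSubalgebra K bA ≤ κ.range.comap Φ := by
    refine Algebra.adjoin_le ?_
    rintro _ (⟨j, rfl⟩ | ⟨j, rfl⟩)
    · exact ⟨g₀ j, (hX j).symm⟩
    · exact ⟨g₁ j, (hY j).symm⟩
  obtain ⟨φ, hφ⟩ := AlgHom.exists_comp_eq_of_injective κ hinj
    (Φ.comp (genericSubalgebra K bA).val) fun x => hle x.2
  replace hφ (x : genericSubalgebra K bA) : κ (φ x) = Φ x.1 := hφ x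
  have hφ0 (x : genericSubalgebra K bA) : φ x = 0 ↔ Φ x.1 = 0 := by
    rw [← hφ, map_eq_zero_iff κ hinj]
  refine ⟨φ, ?_, ?_, fun x => ⟨fun hx => ?_, fun hx => subset_twoSidedSpan _ ⟨x, hx, rfl⟩⟩⟩
  · rw [← AlgHom.range_eq_top, eq_top_iff, ← hgen]
    refine Algebra.adjoin_le ?_
    rintro _ ⟨n, rfl⟩
    have hXmem : genericX K bA n ∈ genericSubalgebra K bA :=
      Algebra.subset_adjoin (Or.inl ⟨n, rfl⟩)
    have hYmem : genericY K bA n ∈ genericSubalgebra K bA :=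
      Algebra.subset_adjoin (Or.inr ⟨n, rfl⟩)
    by_cases h : g n ∈ ℬ 0
    · exact ⟨⟨_, hXmem⟩, hinj ((hφ _).trans ((hX n).trans (by simp [g₀, h])))⟩
    · exact ⟨⟨_, hYmem⟩, hinj ((hφ _).trans ((hY n).trans (by simp [g₁, h])))⟩
  · intro k x hx
    refine hκ.mem_of_injective hℬ.1 (superTensorGrading_isZ2Decomp h𝒜.1 F.isGrading.1) hinj ?_
    rw [hφ]
    exact isGradedHom_tensor_map 𝒜 hζ k _ hx
  · refine (hφ0 x).2 (twoSidedSpan_le (isTwoSidedSubmodule_ker Φ) ?_ hx)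
    rintro _ ⟨y, hy, rfl⟩
    exact (hφ0 y).1 hy

theorem exists_embedding_of_generic_presentation [FiniteDimensional K A] (h𝒜 : IsZ2Grading K 𝒜)
    (hsimple : IsGradedSimple K 𝒜) (hcentral : Subalgebra.center K A = ⊥)
    (hu : ∀ i, bA (Sum.inl i) ∈ 𝒜 0) (hv : ∀ i, bA (Sum.inr i) ∈ 𝒜 1) (hℬ : IsZ2Grading K ℬ)
    {φ : genericSubalgebra K bA →ₐ[K] B} (hsurj : Function.Surjective φ)
    (hφ : ∀ k, ∀ x : genericSubalgebra K bA,
      x.1 ∈ superTensorGrading K 𝒜 (freeSuperGrading K _) k → φ x ∈ ℬ k)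
    (hker : ∀ x : genericSubalgebra K bA,
      x.1 ∈ twoSidedSpan K (Subtype.val '' {y : genericSubalgebra K bA | φ y = 0}) → φ x = 0) :
    ∃ (F : SuperAlg K) (κ : B →ₐ[K] A ⊗[K] F.carrier),
      IsGradedHom K ℬ (superTensorGrading K 𝒜 F.grading) κ ∧ Function.Injective κ := by
  have hΔ := freeSuperGrading_isZ2Grading (K := K) ((Fin a ⊕ Fin b) × ℕ)
  have hC := superTensorGrading_isZ2Grading h𝒜 hΔ
  have hmul : Function.Surjective (AlgHom.mulLeftRight K A) := by
    cases subsingleton_or_nontrivial A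
    · exact Function.surjective_to_subsingleton _
    · exact mulLeftRight_surjective hcentral fun I hI =>
        hsimple.eq_bot_or_eq_top h𝒜 hcentral hI
  have hE := parity_mem_adjoin hC (genericX_or_genericY_mem hu hv)
  have hsplit (k : ZMod 2) (x : genericSubalgebra K bA) : ∃ y z : genericSubalgebra K bA,
      y.1 ∈ superTensorGrading K 𝒜 (freeSuperGrading K _) k ∧
      z.1 ∈ superTensorGrading K 𝒜 (freeSuperGrading K _) (k + 1) ∧ y + z = x := by
    obtain ⟨y, hy, z, hz, hyz⟩ := hC.1.exists_add x.1
    obtain ⟨hy', hz'⟩ := mem_of_parity_mem hC.1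
      (W := Subalgebra.toSubmodule (genericSubalgebra K bA)) hE hy hz (hyz ▸ x.2)
    rcases ZMod.eq_zero_or_eq_one k with rfl | rfl
    · exact ⟨⟨y, hy'⟩, ⟨z, hz'⟩, hy, hz, Subtype.ext hyz⟩
    · exact ⟨⟨z, hz'⟩, ⟨y, hy'⟩, hz, hy, Subtype.ext ((add_comm _ _).trans hyz)⟩
  set P : Set (A ⊗[K] FreeSuperAlgebra K ((Fin a ⊕ Fin b) × ℕ)) :=
    Subtype.val '' {y : genericSubalgebra K bA | φ y = 0}
  have hP : ∀ x ∈ P, parity hC.1 x ∈ P := by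
    rintro _ ⟨x, hx, rfl⟩
    obtain ⟨y, z, hy, hz, rfl⟩ := hsplit 0 x
    have hx : φ (y + z) = 0 := hx
    rw [map_add] at hx
    have hy0 : φ y = 0 := hℬ.1.eq_zero (hφ 0 y hy) (by
      rw [eq_neg_of_add_eq_zero_left hx]
      exact Submodule.neg_mem _ (hφ _ z hz))
    have hz0 : φ z = 0 := by rwa [hy0, zero_add] at hx
    refine ⟨y + (-1 : K) • z, show φ (y + (-1 : K) • z) = 0 by
      rw [map_add, map_smul, hy0, hz0, smul_zero, add_zero], ?_⟩
    change y.1 + (-1 : K) • z.1 = parity hC.1 (y.1 + z.1)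
    rw [map_add, parity_even hC.1 hy, parity_odd hC.1 hz]
    exact congrArg (y.1 + ·) (neg_one_smul K z.1)
  have hI := isTwoSidedSubmodule_twoSidedSpan (K := K) P
  obtain ⟨F, π, hπ, hπ0⟩ := exists_superAlg_quotient hΔ (freeSuperGrading_isSupercommutative _)
    (J := (twoSidedSpan K P).comap (TensorProduct.mk K A _ 1))
    (fun d x hx => by
      have h := hI ((1 : A) ⊗ₜ[K] d) _ hx
      simpa using h)
    (fun y hy z hz hyz => (mem_of_parity_mem hC.1 (parity_mem_twoSidedSpan hC hP)
      (tmul_mem_superTensorGrading h𝒜.2.1 hy (add_zero 0))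
      (tmul_mem_superTensorGrading h𝒜.2.1 hz (zero_add 1))
      (by simpa [TensorProduct.tmul_add] using hyz)).1)
  set Φ := Algebra.TensorProduct.map (AlgHom.id K A) π
  have hΦ : ∀ x, Φ x = 0 ↔ x ∈ twoSidedSpan K P := map_eq_zero_iff_mem bA hmul hI hπ0
  obtain ⟨κ, hκ⟩ := AlgHom.exists_comp_eq_of_surjective φ hsurj
    (Φ.comp (genericSubalgebra K bA).val)
    fun x hx => (hΦ _).2 (subset_twoSidedSpan _ ⟨x, hx, rfl⟩)
  replace hκ (x : genericSubalgebra K bA) : κ (φ x) = Φ x.1 := hκ x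
  refine ⟨F, κ, fun k c hc => ?_, (injective_iff_map_eq_zero κ).2 fun c hc => ?_⟩
  · obtain ⟨x, rfl⟩ := hsurj c
    obtain ⟨y, z, hy, hz, rfl⟩ := hsplit k x
    rw [map_add] at hc ⊢
    have hz0 : φ z = 0 :=
      hℬ.1.eq_zero (((ℬ k).add_mem_iff_right (hφ k y hy)).1 hc) (hφ _ z hz)
    rw [hz0, add_zero, hκ]
    exact isGradedHom_tensor_map 𝒜 hπ k _ hy
  · obtain ⟨x, rfl⟩ := hsurj c
    rw [hκ] at hc
    exact hker x ((hΦ _).1 hc)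

end Embedding

/-- Embedding criterion via the algebra of generic superelements: `B` embeds
into `A ⊗ F` for some supercommutative `F` iff there is a surjective graded homomorphism
`φ : ℰ → B` whose kernel `P` satisfies `(P) ∩ ℰ = P`, where `(P)` is the two-sided ideal of
`A ⊗ Δ` generated by `P`. -/
theorem embedding_iff_generic_presentation
    {K : Type u} [Field K] [CharZero K]
    {A : Type u} [Ring A] [Algebra K A] [FiniteDimensional K A]
    (𝒜 : ZMod 2 → Submodule K A) (h𝒜 : IsZ2Grading K 𝒜)
    (hsimple : IsGradedSimple K 𝒜)
    (hcentral : Subalgebra.center K A = ⊥)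
    {a b : ℕ} (bA : Module.Basis (Fin a ⊕ Fin b) K A)
    (hu : ∀ i : Fin a, bA (Sum.inl i) ∈ 𝒜 0)
    (hv : ∀ i : Fin b, bA (Sum.inr i) ∈ 𝒜 1)
    {B : Type u} [Ring B] [Algebra K B]
    (ℬ : ZMod 2 → Submodule K B) (hℬ : IsZ2Grading K ℬ)
    (hBgen : ∃ g : ℕ → B, (∀ n, g n ∈ ℬ 0 ∨ g n ∈ ℬ 1) ∧
      Algebra.adjoin K (Set.range g) = ⊤) :
    (∃ (F : SuperAlg K) (κ : B →ₐ[K] A ⊗[K] F.carrier),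
      IsGradedHom K ℬ (superTensorGrading K 𝒜 F.grading) κ ∧ Function.Injective κ) ↔
    (∃ φ : (genericSubalgebra K bA : Subalgebra K _) →ₐ[K] B,
      Function.Surjective φ ∧
      (∀ k : ZMod 2, ∀ x : (genericSubalgebra K bA : Subalgebra K _),
        (x : A ⊗[K] FreeSuperAlgebra K ((Fin a ⊕ Fin b) × ℕ)) ∈
          superTensorGrading K 𝒜 (freeSuperGrading K ((Fin a ⊕ Fin b) × ℕ)) k →
        φ x ∈ ℬ k) ∧
      (∀ x : (genericSubalgebra K bA : Subalgebra K _),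
        ((x : A ⊗[K] FreeSuperAlgebra K ((Fin a ⊕ Fin b) × ℕ)) ∈
          twoSidedSpan K (Subtype.val ''
            {y : (genericSubalgebra K bA : Subalgebra K _) | φ y = 0})) ↔ φ x = 0)) := by
  obtain ⟨g, hg, hgen⟩ := hBgen
  constructor
  · rintro ⟨F, κ, hκ, hinj⟩
    exact exists_generic_presentation_of_embedding h𝒜 hu hv hℬ hg hgen F hκ hinj
  · rintro ⟨φ, hsurj, hφ, hker⟩
    exact exists_embedding_of_generic_presentation h𝒜 hsimple hcentral hu hv hℬ hsurj hφ
      fun x => (hker x).1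
end

section
/- Let K be a field of characteristic 0, A a finite-dimensional ℤ₂-graded associative unital K-algebra, B a ℤ₂-graded associative unital K-algebra, and (Ξ, ρ) an A-universal supermap for B. Let G denote the group of graded K-algebra automorphisms of A. Then there exists a group homomorphism σ from G to the group of graded K-algebra automorphisms of Ξ such that for every g ∈ G the graded automorphism ξ_g := g⊗σ(g) of A⊗Ξ satisfies ξ_g∘ρ = ρ. In particular, G acts on A⊗Ξ by graded automorphisms via g ↦ ξ_g, and ρ(B) is contained in the ring of invariants (A⊗Ξ)^G. -/
open TensorProduct

universe u

/-- The group of graded automorphisms of a ℤ₂-graded algebra. -/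
def gradedAut (K : Type u) [Field K] {A : Type u} [Ring A] [Algebra K A]
    (𝒜 : ZMod 2 → Submodule K A) : Subgroup (A ≃ₐ[K] A) where
  carrier := {g | (∀ k : ZMod 2, ∀ a ∈ 𝒜 k, g a ∈ 𝒜 k) ∧
    (∀ k : ZMod 2, ∀ a ∈ 𝒜 k, g.symm a ∈ 𝒜 k)}
  one_mem' := ⟨fun _ _ ha => ha, fun _ _ ha => ha⟩
  mul_mem' := by
    rintro g h ⟨hg1, hg2⟩ ⟨hh1, hh2⟩
    refine ⟨fun k a ha => ?_, fun k a ha => ?_⟩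
    · simpa [AlgEquiv.mul_apply] using hg1 k _ (hh1 k a ha)
    · exact hh2 k _ (hg2 k a ha)
  inv_mem' := by
    rintro g ⟨h1, h2⟩
    refine ⟨fun k a ha => ?_, fun k a ha => ?_⟩
    · exact h2 k a ha
    · show g.symm.symm a ∈ 𝒜 k
      simpa using h1 k a ha

/-- Over a field, tensoring the equalizer of two algebra maps gives the equalizer of the
tensored maps. -/
theorem mem_range_map_equalizer_subtype {K A X Y : Type*} [Field K] [Ring A] [Algebra K A]
    [Ring X] [Algebra K X] [Ring Y] [Algebra K Y] (f g : X →ₐ[K] Y) (t : A ⊗[K] X)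
    (h : Algebra.TensorProduct.map (AlgHom.id K A) f t =
      Algebra.TensorProduct.map (AlgHom.id K A) g t) :
    t ∈ LinearMap.range (TensorProduct.map (LinearMap.id : A →ₗ[K] A)
      (Subalgebra.toSubmodule (AlgHom.equalizer f g)).subtype) := by
  have hex : Function.Exact (Subalgebra.toSubmodule (AlgHom.equalizer f g)).subtype
      (f.toLinearMap - g.toLinearMap) := by
    intro x
    simp [sub_eq_zero, AlgHom.mem_equalizer]
  refine (Module.Flat.lTensor_exact A hex t).1 ?_
  rw [LinearMap.lTensor_sub, LinearMap.sub_apply, sub_eq_zero]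
  exact h

/-- The equalizer of two graded homomorphisms is a graded subalgebra. -/
theorem isGradedSubalgebra_equalizer {K X Y : Type*} [Field K] [Ring X] [Algebra K X]
    [Ring Y] [Algebra K Y] {𝒳 : ZMod 2 → Submodule K X} {𝒴 : ZMod 2 → Submodule K Y}
    (h𝒳 : IsZ2Decomp K 𝒳) (h𝒴 : IsZ2Decomp K 𝒴) {f g : X →ₐ[K] Y}
    (hf : IsGradedHom K 𝒳 𝒴 f) (hg : IsGradedHom K 𝒳 𝒴 g) :
    IsGradedSubalgebra K 𝒳 (AlgHom.equalizer f g) := by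
  refine le_antisymm (fun x hx => ?_) (sup_le inf_le_left inf_le_left)
  have hx' : f x = g x := hx
  obtain ⟨y, hy, z, hz, rfl⟩ := Submodule.mem_sup.1 (h𝒳.1 ▸ Submodule.mem_top : x ∈ 𝒳 0 ⊔ 𝒳 1)
  have heq : f y - g y = g z - f z := by
    rw [map_add, map_add] at hx'
    rw [sub_eq_sub_iff_add_eq_add, hx', add_comm]
  have hzero : f y - g y = 0 := by
    rw [← Submodule.mem_bot K, ← h𝒴.2]
    exact ⟨sub_mem (hf 0 y hy) (hg 0 y hy), heq ▸ sub_mem (hg 1 z hz) (hf 1 z hz)⟩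
  exact Submodule.add_mem_sup ⟨sub_eq_zero.1 hzero, hy⟩
    ⟨(sub_eq_zero.1 (heq ▸ hzero)).symm, hz⟩

/-- Graded homomorphisms out of a universal superscalar algebra are determined by their effect
on the universal supermap. -/
theorem IsUniversalSupermap.hom_ext {K : Type u} [Field K] {A B : Type u} [Ring A] [Algebra K A]
    [Ring B] [Algebra K B] {𝒜 : ZMod 2 → Submodule K A} {ℬ : ZMod 2 → Submodule K B}
    {Ξ : SuperAlg K} {ρ : B →ₐ[K] A ⊗[K] Ξ.carrier} (hU : IsUniversalSupermap K 𝒜 ℬ Ξ ρ)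
    {F : SuperAlg K} {f g : Ξ.carrier →ₐ[K] F.carrier}
    (hf : IsGradedHom K Ξ.grading F.grading f) (hg : IsGradedHom K Ξ.grading F.grading g)
    (h : (Algebra.TensorProduct.map (AlgHom.id K A) f).comp ρ =
      (Algebra.TensorProduct.map (AlgHom.id K A) g).comp ρ) : f = g := by
  have htop := hU.2.1 (AlgHom.equalizer f g)
    (isGradedSubalgebra_equalizer Ξ.isGrading.1 F.isGrading.1 hf hg)
    fun b => mem_range_map_equalizer_subtype f g (ρ b) (DFunLike.congr_fun h b)
  ext x
  exact (htop ▸ Algebra.mem_top : x ∈ AlgHom.equalizer f g)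

/-- A graded map on the first factor preserves the super grading of a tensor product. -/
theorem isGradedHom_map_id {K A A' X : Type*} [Field K] [Ring A] [Algebra K A]
    [Ring A'] [Algebra K A'] [Ring X] [Algebra K X] {𝒜 : ZMod 2 → Submodule K A}
    {𝒜' : ZMod 2 → Submodule K A'} (𝒳 : ZMod 2 → Submodule K X) {f : A →ₐ[K] A'}
    (hf : IsGradedHom K 𝒜 𝒜' f) :
    IsGradedHom K (superTensorGrading K 𝒜 𝒳) (superTensorGrading K 𝒜' 𝒳)
      (Algebra.TensorProduct.map f (AlgHom.id K X)) := by
  have key (i j : ZMod 2) (t : 𝒜 i ⊗[K] 𝒳 j) : Algebra.TensorProduct.map f (AlgHom.id K X)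
      (TensorProduct.map (𝒜 i).subtype (𝒳 j).subtype t) ∈
        LinearMap.range (TensorProduct.map (𝒜' i).subtype (𝒳 j).subtype) := by
    induction t with
    | zero => simp
    | tmul a x => exact ⟨(⟨f a, hf i a a.2⟩ : 𝒜' i) ⊗ₜ x, by simp⟩
    | add s t hs ht => simpa only [map_add] using add_mem hs ht
  intro k t ht
  obtain ⟨_, ⟨y, rfl⟩, _, ⟨z, rfl⟩, rfl⟩ := Submodule.mem_sup.1 ht
  rw [map_add]
  exact Submodule.add_mem_sup (key 0 k y) (key 1 (k + 1) z)

/-- An action of a group by graded endomorphisms is an action by graded automorphisms. -/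
def gradedAutOfEnd {K : Type u} [Field K] {X : Type u} [Ring X] [Algebra K X]
    {𝒳 : ZMod 2 → Submodule K X} {G : Type*} [Group G] (φ : G →* (X →ₐ[K] X))
    (hφ : ∀ g, IsGradedHom K 𝒳 𝒳 (φ g)) : G →* gradedAut K 𝒳 where
  toFun g := ⟨AlgEquiv.ofAlgHom (φ g) (φ g⁻¹)
      (by change φ g * φ g⁻¹ = 1; rw [← map_mul, mul_inv_cancel, map_one])
      (by change φ g⁻¹ * φ g = 1; rw [← map_mul, inv_mul_cancel, map_one]), hφ g, hφ g⁻¹⟩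
  map_one' := by
    ext x
    exact DFunLike.congr_fun (map_one φ) x
  map_mul' g h := by
    ext x
    exact DFunLike.congr_fun (map_mul φ g h) x

/-- The group `G` of graded automorphisms of `A` acts on `A ⊗ Ξ` by graded
automorphisms `ξ_g = g ⊗ σ(g)` fixing `ρ`; in particular `ρ(B) ⊆ (A ⊗ Ξ)^G`. -/
theorem gradedAut_action_on_universal_supermap
    {K : Type u} [Field K] [CharZero K]
    {A : Type u} [Ring A] [Algebra K A] [FiniteDimensional K A]
    (𝒜 : ZMod 2 → Submodule K A) (h𝒜 : IsZ2Grading K 𝒜)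
    {B : Type u} [Ring B] [Algebra K B]
    (ℬ : ZMod 2 → Submodule K B) (hℬ : IsZ2Grading K ℬ)
    (Ξ : SuperAlg K) (ρ : B →ₐ[K] A ⊗[K] Ξ.carrier)
    (hU : IsUniversalSupermap K 𝒜 ℬ Ξ ρ) :
    ∃ σ : gradedAut K 𝒜 →* gradedAut K Ξ.grading,
      ∀ g : gradedAut K 𝒜,
        (Algebra.TensorProduct.map ((g : A ≃ₐ[K] A) : A →ₐ[K] A)
          (((σ g : Ξ.carrier ≃ₐ[K] Ξ.carrier)) : Ξ.carrier →ₐ[K] Ξ.carrier)).comp ρ = ρ := by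
  have hgr (g : gradedAut K 𝒜) : IsGradedHom K 𝒜 𝒜 ((g : A ≃ₐ[K] A) : A →ₐ[K] A) := g.2.1
  choose ζ hζ hζρ using fun g : gradedAut K 𝒜 => hU.2.2 Ξ
    ((Algebra.TensorProduct.map (((g⁻¹ : gradedAut K 𝒜) : A ≃ₐ[K] A) : A →ₐ[K] A)
      (AlgHom.id K Ξ.carrier)).comp ρ)
    fun k b hb => isGradedHom_map_id Ξ.grading (hgr g⁻¹) k _ (hU.1 k b hb)
  have split (f : A →ₐ[K] A) (τ : Ξ.carrier →ₐ[K] Ξ.carrier) :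
      Algebra.TensorProduct.map f τ = (Algebra.TensorProduct.map f (AlgHom.id K _)).comp
        (Algebra.TensorProduct.map (AlgHom.id K A) τ) := by
    rw [← Algebra.TensorProduct.map_comp, AlgHom.comp_id, AlgHom.id_comp]
  have split' (f : A →ₐ[K] A) (τ : Ξ.carrier →ₐ[K] Ξ.carrier) :
      Algebra.TensorProduct.map f τ = (Algebra.TensorProduct.map (AlgHom.id K A) τ).comp
        (Algebra.TensorProduct.map f (AlgHom.id K _)) := by
    rw [← Algebra.TensorProduct.map_comp, AlgHom.comp_id, AlgHom.id_comp]
  let φ : gradedAut K 𝒜 →* (Ξ.carrier →ₐ[K] Ξ.carrier) :=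
    { toFun := ζ
      map_one' := by
        refine hU.hom_ext (hζ 1) (fun _ _ hx => hx) ?_
        rw [hζρ, inv_one]
        rfl
      map_mul' := fun g h => by
        refine hU.hom_ext (hζ _) (fun k x hx => hζ g k _ (hζ h k x hx)) ?_
        have hcomp : Algebra.TensorProduct.map (AlgHom.id K A) (ζ g * ζ h) =
            (Algebra.TensorProduct.map (AlgHom.id K A) (ζ g)).comp
              (Algebra.TensorProduct.map (AlgHom.id K A) (ζ h)) :=
          Algebra.TensorProduct.map_comp (AlgHom.id K A) (AlgHom.id K A) (ζ g) (ζ h)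
        rw [hcomp, AlgHom.comp_assoc, hζρ h, ← AlgHom.comp_assoc, ← split', split _ (ζ g),
          AlgHom.comp_assoc, hζρ g, ← AlgHom.comp_assoc, ← Algebra.TensorProduct.map_comp,
          hζρ, mul_inv_rev]
        rfl }
  refine ⟨gradedAutOfEnd φ hζ, fun g => ?_⟩
  change (Algebra.TensorProduct.map ((g : A ≃ₐ[K] A) : A →ₐ[K] A) (ζ g)).comp ρ = ρ
  rw [split, AlgHom.comp_assoc, hζρ, ← AlgHom.comp_assoc, ← Algebra.TensorProduct.map_comp]
  have hinv : ((g : A ≃ₐ[K] A) : A →ₐ[K] A).comp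
      (((g⁻¹ : gradedAut K 𝒜) : A ≃ₐ[K] A) : A →ₐ[K] A) = AlgHom.id K A := by
    ext a
    exact (g : A ≃ₐ[K] A).apply_symm_apply a
  rw [hinv, AlgHom.comp_id, Algebra.TensorProduct.map_id, AlgHom.id_comp]
end
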